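/- arXiv:2001.10839 — 3 statements merged into one kernel-verified Lean document; each statement's English description precedes it below -/
import Mathlib

section
/- Let k = p^a q^b l with gcd(l, pq) = 1, 0 ≤ a ≤ m−1, 0 ≤ b ≤ n−1, and set ζ_{pq} = β^{p^{m−1} q^{n−1}} (a primitive pq-th root of unity). Then for all 1 ≤ i ≤ m and 1 ≤ j ≤ n: S_1^{(i,j)}(β^k) = (p−1)(q−1)p^{i−1}q^{j−1}/2 (as an element of F_{4^{d*}}) if i ≤ a and j ≤ b; S_1^{(i,j)}(β^k) = Σ_{t ∈ D_1^{(pq)}} ζ_{pq}^{lt} if i = a+1 and j = b+1; S_1^{(i,j)}(β^k) = 0 if i > a+1 or j > b+1; S_1^{(i,j)}(β^k) = 0 if i ≤ a and j = b+1; and S_1^{(i,j)}(β^k) = (q−1)/2 (as an element of F_{4^{d*}}) if i = a+1 and j ≤ b. -/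
open Finset Polynomial

noncomputable section

/-- The field `F₄` with four elements. -/
abbrev F4 : Type := GaloisField 2 2

/-- Generic generalized cyclotomic class of index `0` modulo `M`:
`{ g^(2t) * y^k mod M : 0 ≤ t < dHalf, 0 ≤ k < e }`. -/
def GC0 (g y M dHalf e : ℕ) : Finset ℕ :=
  ((Finset.range dHalf) ×ˢ (Finset.range e)).image
    (fun tk => g ^ (2 * tk.1) * y ^ tk.2 % M)

/-- Generic generalized cyclotomic class of index `1` modulo `M`: `g · GC0 (mod M)`. -/
def GC1 (g y M dHalf e : ℕ) : Finset ℕ :=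
  (GC0 g y M dHalf e).image (fun x => g * x % M)

/-- Class of index `h ∈ {0,1}`. -/
def GC (h g y M dHalf e : ℕ) : Finset ℕ :=
  if h = 0 then GC0 g y M dHalf e else GC1 g y M dHalf e

/-- `e_{i,j} = gcd(p^{i-1}(p-1), q^{j-1}(q-1))`. -/
def eij (p q i j : ℕ) : ℕ := Nat.gcd (p ^ (i - 1) * (p - 1)) (q ^ (j - 1) * (q - 1))

/-- `d_{i,j} = p^{i-1}(p-1) q^{j-1}(q-1) / e_{i,j}`. -/
def dij (p q i j : ℕ) : ℕ := p ^ (i - 1) * (p - 1) * (q ^ (j - 1) * (q - 1)) / eij p q i j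

/-- `D_h^{(p^i q^j)}`. -/
def DPQ (p q g y h i j : ℕ) : Finset ℕ :=
  GC h g y (p ^ i * q ^ j) (dij p q i j / 2) (eij p q i j)

/-- `D_h^{(2 p^i q^j)}`. -/
def D2PQ (p q g y h i j : ℕ) : Finset ℕ :=
  GC h g y (2 * (p ^ i * q ^ j)) (dij p q i j / 2) (eij p q i j)

/-- `D_h^{(p^i)}`. -/
def DP (p g h i : ℕ) : Finset ℕ := GC h g 1 (p ^ i) (p ^ (i - 1) * (p - 1) / 2) 1

/-- `D_h^{(2p^i)}`. -/
def D2P (p g h i : ℕ) : Finset ℕ := GC h g 1 (2 * p ^ i) (p ^ (i - 1) * (p - 1) / 2) 1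

/-- `D_h^{(q^j)}`. -/
def DQ (q g h j : ℕ) : Finset ℕ := GC h g 1 (q ^ j) (q ^ (j - 1) * (q - 1) / 2) 1

/-- `D_h^{(2q^j)}`. -/
def D2Q (q g h j : ℕ) : Finset ℕ := GC h g 1 (2 * q ^ j) (q ^ (j - 1) * (q - 1) / 2) 1

/-- `c · A`. -/
def scaled (c : ℕ) (A : Finset ℕ) : Finset ℕ := A.image (fun x => c * x)

/-- `H_h^{(p^i q^j)} = p^{m-i} q^{n-j} D_h^{(p^i q^j)}`. -/
def HPQ (p q m n g y h i j : ℕ) : Finset ℕ :=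
  scaled (p ^ (m - i) * q ^ (n - j)) (DPQ p q g y h i j)

/-- `H_h^{(2 p^i q^j)} = p^{m-i} q^{n-j} D_h^{(2 p^i q^j)}`. -/
def H2PQ (p q m n g y h i j : ℕ) : Finset ℕ :=
  scaled (p ^ (m - i) * q ^ (n - j)) (D2PQ p q g y h i j)

/-- `H_h^{(p^i)} = p^{m-i} q^n D_h^{(p^i)}`. -/
def HP (p q m n g h i : ℕ) : Finset ℕ := scaled (p ^ (m - i) * q ^ n) (DP p g h i)

/-- `H_h^{(2p^i)} = p^{m-i} q^n D_h^{(2p^i)}`. -/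
def H2P (p q m n g h i : ℕ) : Finset ℕ := scaled (p ^ (m - i) * q ^ n) (D2P p g h i)

/-- `H_h^{(q^j)} = p^m q^{n-j} D_h^{(q^j)}`. -/
def HQ (p q m n g h j : ℕ) : Finset ℕ := scaled (p ^ m * q ^ (n - j)) (DQ q g h j)

/-- `H_h^{(2q^j)} = p^m q^{n-j} D_h^{(2q^j)}`. -/
def H2Q (p q m n g h j : ℕ) : Finset ℕ := scaled (p ^ m * q ^ (n - j)) (D2Q q g h j)

/-- `⋃_{i,j} H_h^{(2p^i q^j)} ∪ ⋃_i H_h^{(2p^i)} ∪ ⋃_j H_h^{(2q^j)}`. -/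
def UnionH (p q m n g y h : ℕ) : Finset ℕ :=
  ((Finset.Icc 1 m).biUnion fun i => (Finset.Icc 1 n).biUnion fun j => H2PQ p q m n g y h i j)
    ∪ ((Finset.Icc 1 m).biUnion fun i => H2P p q m n g h i)
    ∪ ((Finset.Icc 1 n).biUnion fun j => H2Q p q m n g h j)

/-- `⋃_{i,j} 2H_h^{(p^i q^j)} ∪ ⋃_i 2H_h^{(p^i)} ∪ ⋃_j 2H_h^{(q^j)}`. -/
def Union2H (p q m n g y h : ℕ) : Finset ℕ :=
  ((Finset.Icc 1 m).biUnion fun i =>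
      (Finset.Icc 1 n).biUnion fun j => scaled 2 (HPQ p q m n g y h i j))
    ∪ ((Finset.Icc 1 m).biUnion fun i => scaled 2 (HP p q m n g h i))
    ∪ ((Finset.Icc 1 n).biUnion fun j => scaled 2 (HQ p q m n g h j))

/-- The quaternary generalized cyclotomic sequence of period `2 p^m q^n`. -/
def seqS (p q m n g y : ℕ) (a b c d e : F4) (u : ℕ) : F4 :=
  let v := u % (2 * (p ^ m * q ^ n))
  if v = 0 then 0
  else if v = p ^ m * q ^ n then e
  else if v ∈ UnionH p q m n g y 0 then a
  else if v ∈ UnionH p q m n g y 1 then b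
  else if v ∈ Union2H p q m n g y 0 then c
  else if v ∈ Union2H p q m n g y 1 then d
  else 0

/-- The generating polynomial `S(x) = ∑_{u=0}^{2p^m q^n - 1} s_u x^u ∈ F₄[x]`. -/
def genPoly (p q m n g y : ℕ) (a b c d e : F4) : Polynomial F4 :=
  ∑ u ∈ Finset.range (2 * (p ^ m * q ^ n)),
    Polynomial.C (seqS p q m n g y a b c d e u) * Polynomial.X ^ u

/-- The linear complexity of a sequence over a field: the least `L > 0` admitting a linear
recurrence `s_{u+L} = c_1 s_{u+L-1} + ⋯ + c_L s_u`. -/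
def LinearComplexity {F : Type*} [Field F] (s : ℕ → F) : ℕ :=
  sInf {L | 0 < L ∧ ∃ c : Fin L → F,
    ∀ u, s (u + L) = ∑ i : Fin L, c i * s (u + L - 1 - (i : ℕ))}

/-- The numbers below `p ^ i` whose residue modulo `p` lies in `R`. -/
def liftResidues (p i : ℕ) (R : Finset ℕ) : Finset ℕ :=
  (range (p ^ i)).filter fun x => x % p ∈ R

/-- The odd powers of `g` modulo `q`. -/
def oddPowers (g q : ℕ) : Finset ℕ :=
  (range ((q - 1) / 2)).image fun b => g ^ (2 * b + 1) % q

/-- The nonzero residues modulo `p`. -/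
def nonzeroResidues (p : ℕ) : Finset ℕ := (range p).erase 0

lemma geom_sum_eq_zero_of_pow_eq_one {K : Type*} [Field K] {a : K} {N : ℕ} (ha : a ^ N = 1)
    (h1 : a ≠ 1) : ∑ x ∈ range N, a ^ x = 0 := by
  rw [geom_sum_eq h1, ha, sub_self, zero_div]

lemma sum_liftResidues {K : Type*} [Field K] {p i : ℕ} (hp : 0 < p) (hi : 1 ≤ i)
    {R : Finset ℕ} (hR : R ⊆ range p) (a : K) :
    ∑ x ∈ liftResidues p i R, a ^ x =
      (∑ c ∈ R, a ^ c) * ∑ w ∈ range (p ^ (i - 1)), (a ^ p) ^ w := by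
  rw [sum_mul_sum, ← sum_product']
  obtain ⟨i, rfl⟩ : ∃ k, i = k + 1 := ⟨i - 1, by omega⟩
  refine sum_bij' (fun x _ => (x % p, x / p)) (fun z _ => z.1 + p * z.2) ?_ ?_ ?_ ?_ ?_
  · intro x hx
    simp only [liftResidues, mem_filter, mem_range] at hx
    simp only [mem_product, mem_range, Nat.add_sub_cancel]
    refine ⟨hx.2, Nat.div_lt_of_lt_mul ?_⟩
    rw [mul_comm, ← pow_succ]
    exact hx.1
  · rintro ⟨c, w⟩ h
    simp only [mem_product, mem_range, Nat.add_sub_cancel] at h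
    have hc := mem_range.1 (hR h.1)
    simp only [liftResidues, mem_filter, mem_range, Nat.add_mul_mod_self_left,
      Nat.mod_eq_of_lt hc]
    refine ⟨?_, h.1⟩
    rw [pow_succ]
    nlinarith [h.2]
  · intro x _
    exact Nat.mod_add_div x p
  · rintro ⟨c, w⟩ h
    simp only [mem_product] at h
    have hc := mem_range.1 (hR h.1)
    simp [Nat.add_mul_div_left _ _ hp, Nat.mod_eq_of_lt hc, Nat.div_eq_of_lt hc]
  · intro x _
    simp only
    rw [← pow_mul, ← pow_add, Nat.mod_add_div]

lemma sum_liftResidues_eq_zero {K : Type*} [Field K] {p i : ℕ} (hp : 0 < p) (hi : 1 ≤ i)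
    {R : Finset ℕ} (hR : R ⊆ range p) {a : K} (ha : a ^ p ^ i = 1) (h1 : a ^ p ≠ 1) :
    ∑ x ∈ liftResidues p i R, a ^ x = 0 := by
  rw [sum_liftResidues hp hi hR, geom_sum_eq_zero_of_pow_eq_one _ h1, mul_zero]
  rw [← pow_mul, ← pow_succ', Nat.sub_add_cancel hi, ha]

lemma sum_liftResidues_of_pow_eq_one {K : Type*} [Field K] {p i : ℕ} (hp : 0 < p) (hi : 1 ≤ i)
    {R : Finset ℕ} (hR : R ⊆ range p) {a : K} (h1 : a ^ p = 1) :
    ∑ x ∈ liftResidues p i R, a ^ x = (∑ c ∈ R, a ^ c) * (p ^ (i - 1) : ℕ) := by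
  rw [sum_liftResidues hp hi hR, h1]
  simp

lemma sum_nonzeroResidues {K : Type*} [Field K] {p : ℕ} (hp : 0 < p) {a : K} (ha : a ^ p = 1)
    (h1 : a ≠ 1) : ∑ c ∈ nonzeroResidues p, a ^ c = -1 := by
  have h := add_sum_erase (range p) (fun c => a ^ c) (mem_range.2 hp)
  rw [geom_sum_eq_zero_of_pow_eq_one ha h1, pow_zero] at h
  rw [nonzeroResidues]
  linear_combination h

lemma oddPowers_subset {g q : ℕ} (hq : 0 < q) : oddPowers g q ⊆ range q := by
  intro x hx
  simp only [oddPowers, mem_image] at hx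
  obtain ⟨b, -, rfl⟩ := hx
  exact mem_range.2 (Nat.mod_lt _ hq)

lemma coprime_of_orderOf_pos {g N : ℕ} (h : 0 < orderOf (g : ZMod N)) : g.Coprime N :=
  (ZMod.isUnit_iff_coprime g N).1 (orderOf_pos_iff.1 h).isUnit

lemma pow_modEq_pow_iff_of_orderOf {g N r : ℕ} (hr : 0 < r) (h : orderOf (g : ZMod N) = r)
    {a b : ℕ} : g ^ a ≡ g ^ b [MOD N] ↔ a ≡ b [MOD r] := by
  have hu := (orderOf_pos_iff.1 (h.symm ▸ hr)).isUnit
  obtain ⟨u, hu⟩ := hu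
  rw [← ZMod.natCast_eq_natCast_iff, Nat.cast_pow, Nat.cast_pow, ← hu, ← Units.val_pow_eq_pow_val,
    ← Units.val_pow_eq_pow_val, Units.val_inj, pow_eq_pow_iff_modEq, ← orderOf_units, hu, h]

lemma exists_pow_modEq_of_coprime {g N x : ℕ} (hN : 0 < N)
    (h : orderOf (g : ZMod N) = N.totient) (hx : x.Coprime N) : ∃ a, x ≡ g ^ a [MOD N] := by
  have : NeZero N := ⟨hN.ne'⟩
  have hr : 0 < N.totient := Nat.totient_pos.2 hN
  obtain ⟨u, hu⟩ := (orderOf_pos_iff.1 (h.symm ▸ hr)).isUnit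
  have hcard : orderOf u = Nat.card (ZMod N)ˣ := by
    rw [Nat.card_eq_fintype_card, ZMod.card_units_eq_totient, ← orderOf_units, hu, h]
  have hmem : ZMod.unitOfCoprime x hx ∈ Submonoid.powers u := by
    rw [mem_powers_iff_mem_zpowers, (Subgroup.eq_top_of_card_eq _
      ((Nat.card_zpowers u).trans hcard) : Subgroup.zpowers u = ⊤)]
    trivial
  obtain ⟨a, ha⟩ := hmem
  refine ⟨a, ?_⟩
  rw [← ZMod.natCast_eq_natCast_iff, Nat.cast_pow, ← hu, ← Units.val_pow_eq_pow_val]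
  simp only at ha
  rw [ha, ZMod.coe_unitOfCoprime]

lemma card_oddPowers {g q : ℕ} (h : orderOf (g : ZMod q) = q - 1) :
    (oddPowers g q).card = (q - 1) / 2 := by
  rw [oddPowers, card_image_of_injOn, card_range]
  intro a ha b hb hab
  simp only [coe_range, Set.mem_Iio] at ha hb
  have := (pow_modEq_pow_iff_of_orderOf (by omega) h).1 hab
  have := Nat.ModEq.eq_of_lt_of_lt this (by omega) (by omega)
  omega

lemma pow_mod_mem_oddPowers_iff {g q c : ℕ} (hq : 2 < q) (hodd : Odd q)
    (h : orderOf (g : ZMod q) = q - 1) : g ^ c % q ∈ oddPowers g q ↔ Odd c := by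
  have h2 : 2 ∣ q - 1 := by obtain ⟨k, rfl⟩ := hodd; simp
  simp only [oddPowers, mem_image, mem_range]
  constructor
  · rintro ⟨b, -, hb⟩
    have := ((pow_modEq_pow_iff_of_orderOf (by omega) h).1 hb).of_dvd h2
    rw [Nat.odd_iff]
    unfold Nat.ModEq at this
    omega
  · rintro ⟨b, rfl⟩
    refine ⟨b % ((q - 1) / 2), Nat.mod_lt _ (by omega), ?_⟩
    refine (pow_modEq_pow_iff_of_orderOf (by omega) h).2 (Nat.ModEq.add_right 1 ?_)
    have := (Nat.mod_modEq b ((q - 1) / 2)).mul_left' 2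
    rwa [Nat.mul_div_cancel' h2] at this

/-- Every pair of exponents whose second entry is odd comes from a product `g ^ (2t+1) * y ^ k`
with `t` and `k` in the ranges defining the cyclotomic classes. -/
lemma exists_exponents {F G : ℕ} (hF : 0 < F) (hG : 0 < G) (h2G : 2 ∣ G) (a b : ℕ) :
    ∃ t k, t < Nat.lcm F G / 2 ∧ k < Nat.gcd F G ∧ 2 * t + 1 + k ≡ a [MOD F] ∧
      2 * t + 1 ≡ 2 * b + 1 [MOD G] := by
  set X := a + (F - 1) * (2 * b + 1) with hX
  set e := Nat.gcd F G with he
  have hepos : 0 < e := Nat.gcd_pos_of_pos_left _ hF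
  have hcomp : 2 * b + e * (X / e) ≡ 2 * b [MOD Nat.gcd F G] := by
    rw [← he]; simp [Nat.ModEq]
  obtain ⟨s, hs1, hs2⟩ := Nat.chineseRemainder' hcomp
  set r := s % Nat.lcm F G with hr
  have hr1 : r ≡ 2 * b + e * (X / e) [MOD F] :=
    ((Nat.mod_modEq s _).of_dvd (Nat.dvd_lcm_left F G)).trans hs1
  have hr2 : r ≡ 2 * b [MOD G] :=
    ((Nat.mod_modEq s _).of_dvd (Nat.dvd_lcm_right F G)).trans hs2
  have hlt : r < Nat.lcm F G := Nat.mod_lt _ (Nat.lcm_pos hF hG)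
  have heven : r % 2 = 0 := by
    have := hr2.of_dvd h2G
    unfold Nat.ModEq at this
    omega
  have h2l : 2 ∣ Nat.lcm F G := h2G.trans (Nat.dvd_lcm_right F G)
  have h2r : 2 * (r / 2) = r := by omega
  refine ⟨r / 2, X % e, by omega, Nat.mod_lt _ hepos, ?_, ?_⟩
  · rw [h2r]
    have h3 := (hr1.add_right 1).add_right (X % e)
    refine h3.trans ?_
    have h4 : 2 * b + e * (X / e) + 1 + X % e = a + F * (2 * b + 1) := by
      have h5 := Nat.mod_add_div X e
      have h6 : F * (2 * b + 1) = (F - 1) * (2 * b + 1) + (2 * b + 1) := by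
        obtain ⟨f, rfl⟩ : ∃ f, F = f + 1 := ⟨F - 1, by omega⟩
        simp; ring
      omega
    rw [h4]
    simp [Nat.ModEq]
  · rw [h2r]
    exact hr2.add_right 1

lemma mem_GC1_iff {g y M s e x : ℕ} : x ∈ GC 1 g y M s e ↔
    ∃ t k, t < s ∧ k < e ∧ g ^ (2 * t + 1) * y ^ k % M = x := by
  simp only [GC, one_ne_zero, if_false, GC1, GC0, mem_image, mem_product, mem_range, Prod.exists]
  constructor
  · rintro ⟨_, ⟨t, k, ⟨ht, hk⟩, rfl⟩, rfl⟩
    refine ⟨t, k, ht, hk, ?_⟩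
    rw [Nat.mul_mod_mod, pow_succ']
    ring_nf
  · rintro ⟨t, k, ht, hk, rfl⟩
    refine ⟨_, ⟨t, k, ⟨ht, hk⟩, rfl⟩, ?_⟩
    rw [Nat.mul_mod_mod, pow_succ']
    ring_nf

lemma lt_of_mem_GC1 {g y M s e x : ℕ} (hM : 0 < M) (hx : x ∈ GC 1 g y M s e) : x < M := by
  obtain ⟨t, k, -, -, rfl⟩ := mem_GC1_iff.1 hx
  exact Nat.mod_lt _ hM

/-- Exponential sums over a cyclotomic class of index `1` factor through the residues modulo
`p ^ i` and modulo `q ^ j`. -/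
lemma sum_GC1_eq_mul {K : Type*} [Field K] {p q g y i j M : ℕ} (hp : p.Prime) (hq : q.Prime)
    (hpq : p ≠ q) (hqodd : Odd q) (hi : 1 ≤ i) (hj : 1 ≤ j)
    (hgp : orderOf (g : ZMod (p ^ i)) = Nat.totient (p ^ i))
    (hgq : orderOf (g : ZMod (q ^ j)) = Nat.totient (q ^ j))
    (hgq1 : orderOf (g : ZMod q) = q - 1)
    (hyg : y ≡ g [MOD p ^ i]) (hy1 : y ≡ 1 [MOD q ^ j]) (hM : p ^ i * q ^ j ∣ M)
    (hinj : ∀ x ∈ GC 1 g y M (dij p q i j / 2) (eij p q i j),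
      ∀ z ∈ GC 1 g y M (dij p q i j / 2) (eij p q i j), x ≡ z [MOD p ^ i * q ^ j] → x = z)
    {a b : K} (ha : a ^ p ^ i = 1) (hb : b ^ q ^ j = 1) :
    ∑ x ∈ GC 1 g y M (dij p q i j / 2) (eij p q i j), (a * b) ^ x =
      (∑ u ∈ liftResidues p i (nonzeroResidues p), a ^ u) *
        ∑ v ∈ liftResidues q j (oddPowers g q), b ^ v := by
  have hq2 : 2 < q := by
    have := hq.two_le
    obtain ⟨k, rfl⟩ := hqodd
    omega
  have hPpos : 0 < p ^ i := pow_pos hp.pos _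
  have hQpos : 0 < q ^ j := pow_pos hq.pos _
  have hFpos : 0 < (p ^ i).totient := Nat.totient_pos.2 hPpos
  have hGpos : 0 < (q ^ j).totient := Nat.totient_pos.2 hQpos
  have hcop : (p ^ i).Coprime (q ^ j) :=
    Nat.Coprime.pow _ _ ((Nat.coprime_primes hp hq).2 hpq)
  have hpP : p ∣ p ^ i := dvd_pow_self p (by omega)
  have hqQ : q ∣ q ^ j := dvd_pow_self q (by omega)
  have hgcp : g.Coprime p :=
    (coprime_of_orderOf_pos (hgp.symm ▸ hFpos)).coprime_dvd_right hpP
  have hxP : ∀ t k, g ^ (2 * t + 1) * y ^ k % M ≡ g ^ (2 * t + 1 + k) [MOD p ^ i] := by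
    intro t k
    refine ((Nat.mod_modEq _ M).of_dvd ((Dvd.intro _ rfl).trans hM)).trans ?_
    rw [pow_add g (2 * t + 1) k]
    exact (hyg.pow k).mul_left _
  have hxQ : ∀ t k, g ^ (2 * t + 1) * y ^ k % M ≡ g ^ (2 * t + 1) [MOD q ^ j] := by
    intro t k
    refine ((Nat.mod_modEq _ M).of_dvd ((Dvd.intro_left _ rfl).trans hM)).trans ?_
    simpa using (hy1.pow k).mul_left (g ^ (2 * t + 1))
  rw [sum_mul_sum, ← sum_product']
  refine sum_bij (fun x _ => (x % p ^ i, x % q ^ j)) ?_ ?_ ?_ ?_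
  · intro x hx
    obtain ⟨t, k, -, -, rfl⟩ := mem_GC1_iff.1 hx
    simp only [mem_product, liftResidues, mem_filter, mem_range, Nat.mod_lt _ hPpos,
      Nat.mod_lt _ hQpos, true_and, Nat.mod_mod_of_dvd _ hpP, Nat.mod_mod_of_dvd _ hqQ]
    rw [(hxP t k).of_dvd hpP, (hxQ t k).of_dvd hqQ, pow_mod_mem_oddPowers_iff hq2 hqodd hgq1]
    refine ⟨?_, by simp⟩
    simp only [nonzeroResidues, mem_erase, mem_range, Nat.mod_lt _ hp.pos, and_true]
    intro h0
    exact (hp.coprime_iff_not_dvd.1 (hgcp.pow_left _).symm) (Nat.dvd_of_mod_eq_zero h0)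
  · intro x hx z hz h
    simp only [Prod.mk.injEq] at h
    exact hinj x hx z hz ((Nat.modEq_and_modEq_iff_modEq_mul hcop).1 h)
  · rintro ⟨u, v⟩ h
    simp only [mem_product, liftResidues, mem_filter, mem_range] at h
    obtain ⟨⟨hu, hup⟩, hv, hvq⟩ := h
    have hucop : u.Coprime (p ^ i) := by
      refine Nat.Coprime.pow_right _ (hp.coprime_iff_not_dvd.2 fun hd => ?_).symm
      simp [nonzeroResidues, Nat.mod_eq_zero_of_dvd hd] at hup
    have hgcq : g.Coprime q := coprime_of_orderOf_pos (by omega)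
    have hvcop : v.Coprime (q ^ j) := by
      refine Nat.Coprime.pow_right _ (hq.coprime_iff_not_dvd.2 fun hd => ?_).symm
      rw [Nat.mod_eq_zero_of_dvd hd] at hvq
      simp only [oddPowers, mem_image] at hvq
      obtain ⟨c, -, hc⟩ := hvq
      exact (hq.coprime_iff_not_dvd.1 (hgcq.pow_left _).symm) (Nat.dvd_of_mod_eq_zero hc)
    obtain ⟨r, hr⟩ := exists_pow_modEq_of_coprime hPpos hgp hucop
    obtain ⟨s, hs⟩ := exists_pow_modEq_of_coprime hQpos hgq hvcop
    obtain ⟨s, rfl⟩ : Odd s := by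
      rw [← pow_mod_mem_oddPowers_iff hq2 hqodd hgq1]
      rwa [hs.of_dvd hqQ] at hvq
    have h2G : 2 ∣ (q ^ j).totient := by
      rw [Nat.totient_prime_pow hq hj]
      exact Dvd.dvd.mul_left (by obtain ⟨k, rfl⟩ := hqodd; simp) _
    obtain ⟨t, k, ht, hk, h1, h2⟩ := exists_exponents hFpos hGpos h2G r s
    rw [Nat.totient_prime_pow hp hi, Nat.totient_prime_pow hq hj] at ht hk
    refine ⟨_, mem_GC1_iff.2 ⟨t, k, ht, hk, rfl⟩, ?_⟩
    simp only [Prod.mk.injEq]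
    constructor
    · rw [← Nat.mod_eq_of_lt hu]
      exact ((hxP t k).trans ((pow_modEq_pow_iff_of_orderOf hFpos hgp).2 h1)).trans hr.symm
    · rw [← Nat.mod_eq_of_lt hv]
      exact ((hxQ t k).trans ((pow_modEq_pow_iff_of_orderOf hGpos hgq).2 h2)).trans hs.symm
  · intro x _
    simp only
    rw [mul_pow, pow_eq_pow_mod x ha, pow_eq_pow_mod x hb]

lemma IsPrimitiveRoot.exists_pow_of_coprime {K : Type*} [Field K] {P Q : ℕ} (hP : 0 < P)
    (hQ : 0 < Q) (h : P.Coprime Q) {β : K} (hβ : IsPrimitiveRoot β (P * Q)) :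
    ∃ r, r ≡ 1 [MOD P] ∧ r ≡ 0 [MOD Q] ∧ IsPrimitiveRoot (β ^ r) P := by
  obtain ⟨r, hr1, hr0⟩ := Nat.chineseRemainder h 1 0
  refine ⟨r, hr1, hr0, ?_⟩
  obtain ⟨u, rfl⟩ := (Nat.modEq_zero_iff_dvd.1 hr0)
  rw [pow_mul]
  refine (hβ.pow (Nat.mul_pos hP hQ) (mul_comm P Q)).pow_of_coprime u ?_
  have hc : (Q * u).Coprime P := by
    rw [Nat.Coprime, hr1.gcd_eq, Nat.gcd_one_left]
  exact hc.coprime_dvd_left (Dvd.intro_left _ rfl)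

/-- A primitive root of unity of coprime composite order `P * Q` splits as a product of primitive
roots of unity of orders `P` and `Q`. -/
lemma IsPrimitiveRoot.exists_mul_of_coprime {K : Type*} [Field K] {P Q : ℕ} (hP : 0 < P)
    (hQ : 0 < Q) (h : P.Coprime Q) {β : K} (hβ : IsPrimitiveRoot β (P * Q)) :
    ∃ a b : K, IsPrimitiveRoot a P ∧ IsPrimitiveRoot b Q ∧ β = a * b := by
  obtain ⟨r, hr1, hr0, hr⟩ := hβ.exists_pow_of_coprime hP hQ h
  obtain ⟨s, hs1, hs0, hs⟩ :=
    (mul_comm P Q ▸ hβ : IsPrimitiveRoot β (Q * P)).exists_pow_of_coprime hQ hP h.symm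
  refine ⟨β ^ r, β ^ s, hr, hs, ?_⟩
  have hrs : r + s ≡ 1 [MOD P * Q] :=
    (Nat.modEq_and_modEq_iff_modEq_mul h).1 ⟨hr1.add hs0, hr0.add hs1⟩
  rw [← pow_add, pow_eq_pow_mod _ hβ.pow_eq_one, hrs, ← pow_eq_pow_mod _ hβ.pow_eq_one, pow_one]

lemma IsPrimitiveRoot.pow_mul_eq_one_iff {K : Type*} [Field K] {p m r w : ℕ} (hp : p.Prime)
    {a : K} (ha : IsPrimitiveRoot a (p ^ m)) (hw : w.Coprime p) :
    a ^ (p ^ r * w) = 1 ↔ m ≤ r := by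
  rw [ha.pow_eq_one_iff_dvd, (hw.symm.pow_left m).dvd_mul_right, Nat.pow_dvd_pow_iff_le_right
    hp.one_lt]

lemma two_eq_zero_of_card {K : Type*} [Field K] [Fintype K] {d : ℕ}
    (hK : Fintype.card K = 4 ^ d) : (2 : K) = 0 := by
  have h : ((Fintype.card K : ℕ) : K) = 0 := Nat.cast_card_eq_zero K
  rw [hK] at h
  push_cast at h
  have h4 : (2 : K) ^ 2 = 0 := by
    rw [← eq_zero_of_pow_eq_zero h]; norm_num
  exact eq_zero_of_pow_eq_zero h4

lemma natCast_eq_one_of_odd {K : Type*} [Field K] (h2 : (2 : K) = 0) {N : ℕ} (hN : Odd N) :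
    (N : K) = 1 := by
  obtain ⟨k, rfl⟩ := hN
  simp [h2]

lemma natCast_eq_zero_of_even {K : Type*} [Field K] (h2 : (2 : K) = 0) {N : ℕ} (hN : Even N) :
    (N : K) = 0 := by
  obtain ⟨k, rfl⟩ := hN
  rw [← two_mul, Nat.cast_mul, Nat.cast_two, h2, zero_mul]

/-- All members of a class modulo `2 * N` are odd, so for odd `N` they are determined by their
residues modulo `N`. -/
lemma GC1_eq_of_modEq {g y N s e : ℕ} (hg : Odd g) (hy : Odd y) (hN : Odd N) :
    ∀ x ∈ GC 1 g y (2 * N) s e, ∀ z ∈ GC 1 g y (2 * N) s e, x ≡ z [MOD N] → x = z := by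
  have hodd : ∀ x ∈ GC 1 g y (2 * N) s e, x < 2 * N ∧ x % 2 = 1 := by
    intro x hx
    refine ⟨lt_of_mem_GC1 (by have := hN.pos; omega) hx, ?_⟩
    obtain ⟨t, k, -, -, rfl⟩ := mem_GC1_iff.1 hx
    rw [Nat.mod_mod_of_dvd _ (Dvd.intro _ rfl), ← Nat.odd_iff]
    exact hg.pow.mul hy.pow
  intro x hx z hz h
  have h2 : x ≡ z [MOD 2] := (hodd x hx).2.trans (hodd z hz).2.symm
  exact Nat.ModEq.eq_of_lt_of_lt ((Nat.modEq_and_modEq_iff_modEq_mul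
    (Nat.coprime_two_left.2 hN)).1 ⟨h2, h⟩) (hodd x hx).1 (hodd z hz).1

lemma neg_one_eq_one {K : Type*} [Field K] (h2 : (2 : K) = 0) : (-1 : K) = 1 := by
  linear_combination -h2

theorem statement5
    (p q m n g y : ℕ)
    (hp : p.Prime) (hq : q.Prime) (hpq : p ≠ q) (hpodd : Odd p) (hqodd : Odd q)
    (hm : 1 ≤ m) (hn : 1 ≤ n) (hgodd : Odd g)
    (hgp : ∀ i, 1 ≤ i → i ≤ m → orderOf (g : ZMod (p ^ i)) = Nat.totient (p ^ i))
    (hg2p : ∀ i, 1 ≤ i → i ≤ m → orderOf (g : ZMod (2 * p ^ i)) = Nat.totient (2 * p ^ i))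
    (hgq : ∀ j, 1 ≤ j → j ≤ n → orderOf (g : ZMod (q ^ j)) = Nat.totient (q ^ j))
    (hg2q : ∀ j, 1 ≤ j → j ≤ n → orderOf (g : ZMod (2 * q ^ j)) = Nat.totient (2 * q ^ j))
    (hylt : y < 2 * (p ^ m * q ^ n))
    (hyg : y ≡ g [MOD 2 * p ^ m]) (hy1 : y ≡ 1 [MOD 2 * q ^ n])
    (K : Type*) [Field K] [Fintype K]
    (hK : Fintype.card K = 4 ^ orderOf (4 : ZMod (p ^ m * q ^ n)))
    (β : K) (hβ : IsPrimitiveRoot β (p ^ m * q ^ n))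
    (A B l : ℕ) (hA : A ≤ m - 1) (hB : B ≤ n - 1) (hl : Nat.gcd l (p * q) = 1)
    : ∀ i j, 1 ≤ i → i ≤ m → 1 ≤ j → j ≤ n →
      ((i ≤ A ∧ j ≤ B →
          ∑ t ∈ H2PQ p q m n g y 1 i j, (β ^ (p ^ A * q ^ B * l)) ^ t
            = (((p - 1) * (q - 1) * p ^ (i - 1) * q ^ (j - 1) / 2 : ℕ) : K)) ∧
        (i = A + 1 ∧ j = B + 1 →
          ∑ t ∈ H2PQ p q m n g y 1 i j, (β ^ (p ^ A * q ^ B * l)) ^ t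
            = ∑ t ∈ DPQ p q g y 1 1 1, (β ^ (p ^ (m - 1) * q ^ (n - 1))) ^ (l * t)) ∧
        (A + 1 < i ∨ B + 1 < j →
          ∑ t ∈ H2PQ p q m n g y 1 i j, (β ^ (p ^ A * q ^ B * l)) ^ t = 0) ∧
        (i ≤ A ∧ j = B + 1 →
          ∑ t ∈ H2PQ p q m n g y 1 i j, (β ^ (p ^ A * q ^ B * l)) ^ t = 0) ∧
        (i = A + 1 ∧ j ≤ B →
          ∑ t ∈ H2PQ p q m n g y 1 i j, (β ^ (p ^ A * q ^ B * l)) ^ t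
            = (((q - 1) / 2 : ℕ) : K))) := by
  intro i j hi him hj hjn
  have h2 : (2 : K) = 0 := two_eq_zero_of_card hK
  have hcop : p.Coprime q := (Nat.coprime_primes hp hq).2 hpq
  have hlp : l.Coprime p := Nat.Coprime.coprime_mul_right_right hl
  have hlq : l.Coprime q := Nat.Coprime.coprime_mul_left_right hl
  have hgp1 : orderOf (g : ZMod (p ^ 1)) = Nat.totient (p ^ 1) := hgp 1 le_rfl hm
  have hgq1 : orderOf (g : ZMod (q ^ 1)) = Nat.totient (q ^ 1) := hgq 1 le_rfl hn
  have hgq1' : orderOf (g : ZMod q) = q - 1 := by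
    rwa [pow_one, Nat.totient_prime hq] at hgq1
  have hyp : ∀ k ≤ m, y ≡ g [MOD p ^ k] := fun k hk =>
    hyg.of_dvd ((pow_dvd_pow p hk).trans (Dvd.intro_left _ rfl))
  have hyq : ∀ k ≤ n, y ≡ 1 [MOD q ^ k] := fun k hk =>
    hy1.of_dvd ((pow_dvd_pow q hk).trans (Dvd.intro_left _ rfl))
  have hyodd : Odd y := by
    rw [Nat.odd_iff]
    exact hy1.of_dvd (Dvd.intro _ rfl)
  obtain ⟨a, b, ha, hb, rfl⟩ := hβ.exists_mul_of_coprime (pow_pos hp.pos m) (pow_pos hq.pos n)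
    (Nat.Coprime.pow _ _ hcop)
  set N := p ^ A * q ^ B * l * (p ^ (m - i) * q ^ (n - j)) with hN
  -- the orders of the `p`- and `q`-components of the evaluation point
  have haN : ∀ s, (a ^ N) ^ p ^ s = 1 ↔ i ≤ A + s := by
    intro s
    have h : N * p ^ s = p ^ (A + (m - i) + s) * (q ^ (B + (n - j)) * l) := by
      rw [hN]; ring
    rw [← pow_mul, h, ha.pow_mul_eq_one_iff hp ((hcop.symm.pow_left _).mul_left hlp)]
    omega
  have hbN : ∀ s, (b ^ N) ^ q ^ s = 1 ↔ j ≤ B + s := by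
    intro s
    have h : N * q ^ s = q ^ (B + (n - j) + s) * (p ^ (A + (m - i)) * l) := by
      rw [hN]; ring
    rw [← pow_mul, h, hb.pow_mul_eq_one_iff hq ((hcop.pow_left _).mul_left hlq)]
    omega
  have haN0 : a ^ N = 1 ↔ i ≤ A := by simpa using haN 0
  have hbN0 : b ^ N = 1 ↔ j ≤ B := by simpa using hbN 0
  have haN1 : (a ^ N) ^ p = 1 ↔ i ≤ A + 1 := by simpa using haN 1
  have hbN1 : (b ^ N) ^ q = 1 ↔ j ≤ B + 1 := by simpa using hbN 1
  have hmain : ∑ t ∈ H2PQ p q m n g y 1 i j, ((a * b) ^ (p ^ A * q ^ B * l)) ^ t =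
      (∑ u ∈ liftResidues p i (nonzeroResidues p), (a ^ N) ^ u) *
        ∑ v ∈ liftResidues q j (oddPowers g q), (b ^ N) ^ v := by
    rw [← sum_GC1_eq_mul hp hq hpq hqodd hi hj (hgp i hi him) (hgq j hj hjn) hgq1' (hyp i him)
      (hyq j hjn) (Dvd.intro_left 2 rfl) (GC1_eq_of_modEq hgodd hyodd ?_) ((haN i).2 (by omega))
      ((hbN j).2 (by omega))]
    · rw [H2PQ, scaled, sum_image]
      · refine sum_congr rfl fun x _ => ?_
        rw [← mul_pow, ← pow_mul, ← pow_mul, hN]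
        ring_nf
      · intro x _ z _ h
        exact Nat.eq_of_mul_eq_mul_left
          (Nat.mul_pos (pow_pos hp.pos _) (pow_pos hq.pos _)) h
    · exact (hpodd.pow).mul hqodd.pow
  have hRp : nonzeroResidues p ⊆ range p := erase_subset _ _
  have hRq : oddPowers g q ⊆ range q := oddPowers_subset hq.pos
  have hpi : ((p ^ (i - 1) : ℕ) : K) = 1 := natCast_eq_one_of_odd h2 hpodd.pow
  have hqj : ((q ^ (j - 1) : ℕ) : K) = 1 := natCast_eq_one_of_odd h2 hqodd.pow
  have hpsum1 : i ≤ A + 1 → ∑ u ∈ liftResidues p i (nonzeroResidues p), (a ^ N) ^ u =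
      ∑ u ∈ nonzeroResidues p, (a ^ N) ^ u := fun h => by
    rw [sum_liftResidues_of_pow_eq_one hp.pos hi hRp (haN1.2 h), hpi, mul_one]
  have hqsum1 : j ≤ B + 1 → ∑ v ∈ liftResidues q j (oddPowers g q), (b ^ N) ^ v =
      ∑ v ∈ oddPowers g q, (b ^ N) ^ v := fun h => by
    rw [sum_liftResidues_of_pow_eq_one hq.pos hj hRq (hbN1.2 h), hqj, mul_one]
  have hpm1 : ((p - 1 : ℕ) : K) = 0 := natCast_eq_zero_of_even h2 (Nat.Odd.sub_odd hpodd odd_one)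
  have hpsum0 : i ≤ A → ∑ u ∈ nonzeroResidues p, (a ^ N) ^ u = 0 := fun h => by
    simp [haN0.2 h, nonzeroResidues, card_erase_of_mem, hp.pos, hpm1]
  have hqsum0 : j ≤ B → ∑ v ∈ oddPowers g q, (b ^ N) ^ v = (((q - 1) / 2 : ℕ) : K) := fun h => by
    simp [hbN0.2 h, card_oddPowers hgq1']
  rw [hmain]
  refine ⟨?_, ?_, ?_, ?_, ?_⟩
  · rintro ⟨h, -⟩
    rw [hpsum1 (by omega), hpsum0 h, zero_mul, natCast_eq_zero_of_even h2]
    obtain ⟨r, rfl⟩ := hpodd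
    obtain ⟨s, rfl⟩ := hqodd
    refine ⟨r * s * (2 * r + 1) ^ (i - 1) * (2 * s + 1) ^ (j - 1), ?_⟩
    refine Nat.div_eq_of_eq_mul_left two_pos ?_
    simp only [Nat.add_sub_cancel]
    ring
  · rintro ⟨h, h'⟩
    rw [hpsum1 (by omega), hqsum1 (by omega)]
    have hNeq : N = p ^ (m - 1) * q ^ (n - 1) * l := by
      rw [hN, show m - 1 = A + (m - i) by omega, show n - 1 = B + (n - j) by omega]
      ring
    have hap : (a ^ N) ^ p = 1 := haN1.2 h.le
    have hbq : (b ^ N) ^ q = 1 := hbN1.2 h'.le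
    have hDPQ := sum_GC1_eq_mul hp hq hpq hqodd le_rfl le_rfl hgp1 hgq1 hgq1' (hyp 1 hm) (hyq 1 hn)
      dvd_rfl (fun x hx z hz hxz => Nat.ModEq.eq_of_lt_of_lt hxz
        (lt_of_mem_GC1 (Nat.mul_pos (pow_pos hp.pos _) (pow_pos hq.pos _)) hx)
        (lt_of_mem_GC1 (Nat.mul_pos (pow_pos hp.pos _) (pow_pos hq.pos _)) hz))
      (a := a ^ N) (b := b ^ N) (by rwa [pow_one]) (by rwa [pow_one])
    rw [sum_liftResidues_of_pow_eq_one hp.pos le_rfl hRp hap,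
      sum_liftResidues_of_pow_eq_one hq.pos le_rfl hRq hbq] at hDPQ
    simp only [Nat.sub_self, pow_zero, Nat.cast_one, mul_one] at hDPQ
    rw [← hDPQ, DPQ]
    refine sum_congr rfl fun x _ => ?_
    rw [← mul_pow, ← pow_mul, ← pow_mul, hNeq, mul_assoc]
  · rintro (h | h)
    · rw [sum_liftResidues_eq_zero hp.pos hi hRp ((haN i).2 (by omega)) (by rw [Ne, haN1]; omega),
        zero_mul]
    · rw [sum_liftResidues_eq_zero hq.pos hj hRq ((hbN j).2 (by omega)) (by rw [Ne, hbN1]; omega),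
        mul_zero]
  · rintro ⟨h, -⟩
    rw [hpsum1 (by omega), hpsum0 h, zero_mul]
  · rintro ⟨h, h'⟩
    rw [hpsum1 (by omega), hqsum1 (by omega), hqsum0 h', sum_nonzeroResidues hp.pos
      (haN1.2 (by omega)) (by rw [Ne, haN0]; omega), neg_one_eq_one h2, one_mul]

end
end

section
/- Suppose p ≡ ±1 (mod 8) and q ≡ ±1 (mod 8). Then for every integer k with 1 ≤ k ≤ p^m q^n − 1, the generating polynomial of the quaternary generalized cyclotomic sequence S satisfies S(β^k) = e + b + d in F_{4^{d*}}. -/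
open Finset Polynomial

noncomputable section

/-- `x` lies, modulo `M`, in the coset of index `h` of the monoid generated by `g ^ 2` and `y`. -/
def InClass (h g y M x : ℕ) : Prop :=
  ∃ t k, x ≡ (if h = 0 then 1 else g) * (g ^ (2 * t) * y ^ k) [MOD M]

/-- The properties of the parameters of a generalized cyclotomic class that make it the
kernel (index `0`) of a quadratic character modulo `M` which is trivial at `2`. -/
structure IsQuadratic (g y M D E : ℕ) : Prop where
  odd_left : Odd g
  odd_right : Odd y
  odd_modulus : Odd M
  bounded : ∀ t k, ∃ t' < D, ∃ k' < E, g ^ (2 * t') * y ^ k' ≡ g ^ (2 * t) * y ^ k [MOD M]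
  two : ∃ t k, 2 ≡ g ^ (2 * t) * y ^ k [MOD M]
  cover : ∀ x, x.Coprime M → InClass 0 g y M x ∨ InClass 1 g y M x

theorem InClass.congr {h g y M x z : ℕ} (hx : InClass h g y M x) (hxz : z ≡ x [MOD M]) :
    InClass h g y M z := by
  obtain ⟨t, k, H⟩ := hx
  exact ⟨t, k, hxz.trans H⟩

theorem InClass.mul {h g y M x z : ℕ} (hz : InClass 0 g y M z) (hx : InClass h g y M x) :
    InClass h g y M (z * x) := by
  obtain ⟨t, k, H⟩ := hz
  obtain ⟨t', k', H'⟩ := hx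
  refine ⟨t + t', k + k', ?_⟩
  convert H.mul H' using 1
  simp only [if_true]
  ring

theorem InClass.pow {g y M z : ℕ} (hz : InClass 0 g y M z) (r : ℕ) :
    InClass 0 g y M (z ^ r) := by
  induction r with
  | zero => exact ⟨0, 0, by simp [Nat.ModEq.refl]⟩
  | succ r ih => rw [pow_succ']; exact hz.mul ih

namespace IsQuadratic

variable {g y M D E : ℕ}

theorem inClass_two (H : IsQuadratic g y M D E) : InClass 0 g y M 2 := by
  obtain ⟨t, k, h⟩ := H.two
  exact ⟨t, k, by simpa using h⟩

theorem inClass_two_mul_iff (H : IsQuadratic g y M D E) {h x : ℕ} :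
    InClass h g y M (2 * x) ↔ InClass h g y M x := by
  refine ⟨fun hx => ?_, fun hx => H.inClass_two.mul hx⟩
  have h1 := (H.inClass_two.pow (M.totient - 1)).mul hx
  refine h1.congr ?_
  have h2 : 2 ^ M.totient ≡ 1 [MOD M] := Nat.ModEq.pow_totient H.odd_modulus.coprime_two_left
  have h3 : 0 < M.totient := Nat.totient_pos.2 H.odd_modulus.pos
  have h4 : 2 ^ (M.totient - 1) * (2 * x) = 2 ^ M.totient * x := by
    obtain ⟨r, hr⟩ := Nat.exists_eq_succ_of_ne_zero h3.ne'
    rw [hr, Nat.succ_sub_one, pow_succ]; ring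
  rw [h4]
  simpa using (h2.mul_right x).symm

theorem mem_GC_iff_exists (g y N D E h x : ℕ) (hN : 0 < N) :
    x ∈ GC h g y N D E ↔ x < N ∧ ∃ t < D, ∃ k < E,
      x ≡ (if h = 0 then 1 else g) * (g ^ (2 * t) * y ^ k) [MOD N] := by
  have key : x ∈ GC h g y N D E ↔ ∃ t < D, ∃ k < E,
      ((if h = 0 then 1 else g) * (g ^ (2 * t) * y ^ k)) % N = x := by
    unfold GC
    split_ifs
    · simp only [GC0, mem_image, mem_product, mem_range, Prod.exists, one_mul]
      exact ⟨fun ⟨t, k, ⟨h1, h2⟩, h3⟩ => ⟨t, h1, k, h2, h3⟩,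
        fun ⟨t, h1, k, h2, h3⟩ => ⟨t, k, ⟨h1, h2⟩, h3⟩⟩
    · simp only [GC1, GC0, mem_image, mem_product, mem_range, Prod.exists]
      constructor
      · rintro ⟨_, ⟨t, k, ⟨h1, h2⟩, rfl⟩, rfl⟩
        exact ⟨t, h1, k, h2, by rw [Nat.mul_mod_mod]⟩
      · rintro ⟨t, h1, k, h2, rfl⟩
        exact ⟨_, ⟨t, k, ⟨h1, h2⟩, rfl⟩, by rw [Nat.mul_mod_mod]⟩
  rw [key]
  constructor
  · rintro ⟨t, h1, k, h2, rfl⟩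
    exact ⟨Nat.mod_lt _ hN, t, h1, k, h2, Nat.mod_modEq _ _⟩
  · rintro ⟨hx, t, h1, k, h2, h3⟩
    exact ⟨t, h1, k, h2, by rw [← h3, Nat.mod_eq_of_lt hx]⟩

theorem mem_GC_iff (H : IsQuadratic g y M D E) {h x : ℕ} :
    x ∈ GC h g y M D E ↔ x < M ∧ InClass h g y M x := by
  rw [mem_GC_iff_exists _ _ _ _ _ _ _ H.odd_modulus.pos]
  refine and_congr_right fun _ => ⟨fun ⟨t, _, k, _, h3⟩ => ⟨t, k, h3⟩, fun ⟨t, k, h3⟩ => ?_⟩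
  obtain ⟨t', ht', k', hk', h4⟩ := H.bounded t k
  exact ⟨t', ht', k', hk', h3.trans (h4.symm.mul_left _)⟩

theorem mem_GC_two_mul_iff (H : IsQuadratic g y M D E) {h x : ℕ} :
    x ∈ GC h g y (2 * M) D E ↔ x < 2 * M ∧ Odd x ∧ InClass h g y M x := by
  have hodd : ∀ t k, Odd ((if h = 0 then 1 else g) * (g ^ (2 * t) * y ^ k)) := by
    intro t k
    refine Odd.mul ?_ (H.odd_left.pow.mul H.odd_right.pow)
    split_ifs
    exacts [odd_one, H.odd_left]
  rw [mem_GC_iff_exists _ _ _ _ _ _ _ (by have := H.odd_modulus.pos; lia)]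
  refine and_congr_right fun _ => ⟨fun ⟨t, _, k, _, h3⟩ => ⟨?_, t, k, ?_⟩, fun ⟨ho, t, k, h3⟩ => ?_⟩
  · have h4 : x % 2 = _ % 2 := h3.of_mul_right M
    rw [Nat.odd_iff, h4]
    exact Nat.odd_iff.1 (hodd t k)
  · exact h3.of_mul_left 2
  · obtain ⟨t', ht', k', hk', h4⟩ := H.bounded t k
    refine ⟨t', ht', k', hk', ?_⟩
    rw [← Nat.modEq_and_modEq_iff_modEq_mul H.odd_modulus.coprime_two_left]
    exact ⟨(Nat.odd_iff.1 ho).trans (Nat.odd_iff.1 (hodd t' k')).symm,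
      h3.trans (h4.symm.mul_left _)⟩

theorem mem_scaled_iff (H : IsQuadratic g y M D E) {c h u v : ℕ} (hu : Odd u) (hv : Even v)
    (hult : u < 2 * (c * M)) (hvlt : v < 2 * (c * M)) (huv : u ≡ v [MOD c * M]) :
    u ∈ scaled c (GC h g y (2 * M) D E) ↔ v ∈ scaled 2 (scaled c (GC h g y M D E)) := by
  have hc : 0 < c := Nat.pos_of_ne_zero (by rintro rfl; simp at hult)
  have hdvd : c ∣ u ↔ c ∣ v := (huv.of_mul_right M).dvd_iff dvd_rfl
  simp only [scaled, mem_image, exists_exists_and_eq_and, H.mem_GC_iff, H.mem_GC_two_mul_iff]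
  constructor
  · rintro ⟨x, ⟨hx, hxo, hxc⟩, rfl⟩
    have hco : Odd c := (Nat.odd_mul.1 hu).1
    obtain ⟨x', rfl⟩ : 2 * c ∣ v := Nat.Coprime.mul_dvd_of_dvd_of_dvd hco.coprime_two_left
      hv.two_dvd (hdvd.1 (dvd_mul_right _ _))
    refine ⟨x', ⟨?_, ?_⟩, by ring⟩
    · rw [← mul_assoc] at hvlt
      exact lt_of_mul_lt_mul_left hvlt (Nat.zero_le _)
    · rw [mul_comm 2 c, mul_assoc] at huv
      exact H.inClass_two_mul_iff.1 (hxc.congr (Nat.ModEq.mul_left_cancel' hc.ne' huv).symm)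
  · rintro ⟨x', ⟨hx, hxc⟩, rfl⟩
    obtain ⟨x, rfl⟩ := hdvd.2 ((dvd_mul_right c x').mul_left 2)
    refine ⟨x, ⟨?_, (Nat.odd_mul.1 hu).2, ?_⟩, rfl⟩
    · rw [mul_left_comm] at hult
      exact lt_of_mul_lt_mul_left hult (Nat.zero_le _)
    · rw [mul_left_comm] at huv
      exact (H.inClass_two_mul_iff.2 hxc).congr (Nat.ModEq.mul_left_cancel' hc.ne' huv)

theorem odd_of_mem_scaled (H : IsQuadratic g y M D E) {c h u : ℕ} (hc : Odd c)
    (hu : u ∈ scaled c (GC h g y (2 * M) D E)) : Odd u := by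
  simp only [scaled, mem_image, H.mem_GC_two_mul_iff] at hu
  obtain ⟨x, ⟨-, hx, -⟩, rfl⟩ := hu
  exact hc.mul hx

theorem mem_scaled_or (H : IsQuadratic g y M D E) {c x : ℕ} (hx : Odd x) (hlt : x < 2 * M)
    (hcop : x.Coprime M) :
    c * x ∈ scaled c (GC 0 g y (2 * M) D E) ∨ c * x ∈ scaled c (GC 1 g y (2 * M) D E) :=
  (H.cover x hcop).imp
    (fun h => mem_image_of_mem _ (H.mem_GC_two_mul_iff.2 ⟨hlt, hx, h⟩))
    (fun h => mem_image_of_mem _ (H.mem_GC_two_mul_iff.2 ⟨hlt, hx, h⟩))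

end IsQuadratic

section PrimePower

theorem coprime_of_orderOf_eq_totient {g N : ℕ} (hN : 0 < N)
    (hg : orderOf (g : ZMod N) = N.totient) : g.Coprime N := by
  have : NeZero N := ⟨hN.ne'⟩
  have h : IsUnit (g : ZMod N) := by
    refine IsUnit.of_pow_eq_one (pow_orderOf_eq_one _) ?_
    rw [hg]
    exact (Nat.totient_pos.2 hN).ne'
  exact (ZMod.isUnit_iff_coprime g N).1 h

theorem exists_modEq_pow_of_orderOf_eq_totient {g N : ℕ} (hN : 0 < N)
    (hg : orderOf (g : ZMod N) = N.totient) {x : ℕ} (hx : x.Coprime N) :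
    ∃ s, x ≡ g ^ s [MOD N] := by
  have : NeZero N := ⟨hN.ne'⟩
  have hgc := coprime_of_orderOf_eq_totient hN hg
  have h1 : orderOf (ZMod.unitOfCoprime g hgc) = Nat.card (ZMod N)ˣ := by
    rw [← orderOf_units, ZMod.coe_unitOfCoprime, hg, Nat.card_eq_fintype_card,
      ZMod.card_units_eq_totient]
  have h2 : ZMod.unitOfCoprime x hx ∈ Submonoid.powers (ZMod.unitOfCoprime g hgc) :=
    mem_powers_iff_mem_zpowers.2
      ((Subgroup.eq_top_of_card_eq _ ((Nat.card_zpowers _).trans h1)).ge (Subgroup.mem_top _))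
  obtain ⟨s, hs⟩ := h2
  refine ⟨s, ?_⟩
  rw [← ZMod.natCast_eq_natCast_iff]
  have := congrArg Units.val hs
  simpa using this.symm

theorem pow_modEq_pow_of_modEq_totient {g N a b : ℕ} (hg : g.Coprime N)
    (h : a ≡ b [MOD N.totient]) : g ^ a ≡ g ^ b [MOD N] := by
  have key : ∀ a, g ^ a ≡ g ^ (a % N.totient) [MOD N] := by
    intro a
    conv_lhs => rw [← Nat.mod_add_div a N.totient, pow_add, pow_mul]
    simpa using ((Nat.ModEq.pow_totient hg).pow (a / N.totient)).mul_left
      (g ^ (a % N.totient))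
  have h' : a % N.totient = b % N.totient := h
  exact (key a).trans (h' ▸ (key b).symm)

theorem not_isSquare_of_orderOf_eq_totient {p g : ℕ} (hp : p.Prime) (hp2 : Odd p)
    (hg : orderOf (g : ZMod p) = p.totient) : ¬ IsSquare (g : ZMod p) := by
  have : Fact p.Prime := ⟨hp⟩
  rintro ⟨w, hw⟩
  have hp3 : 3 ≤ p := by
    obtain ⟨r, hr⟩ := hp2
    have := hp.two_le
    lia
  have hw0 : w ≠ 0 := by
    rintro rfl
    have := coprime_of_orderOf_eq_totient hp.pos hg
    have h0 : IsUnit (g : ZMod p) := (ZMod.isUnit_iff_coprime g p).2 this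
    rw [hw] at h0
    simp at h0
  have h1 : (g : ZMod p) ^ ((p - 1) / 2) = 1 := by
    have : 2 * ((p - 1) / 2) = p - 1 := by
      obtain ⟨r, hr⟩ := hp2
      lia
    rw [hw, ← sq, ← pow_mul, this, ZMod.pow_card_sub_one_eq_one hw0]
  have h2 := orderOf_dvd_of_pow_eq_one h1
  rw [hg, Nat.totient_prime hp] at h2
  have := Nat.le_of_dvd (by lia) h2
  lia

theorem two_modEq_even_pow {p i g : ℕ} (hp : p.Prime) (hp2 : Odd p) (hi : 1 ≤ i)
    (hg1 : orderOf (g : ZMod p) = p.totient) (hg : orderOf (g : ZMod (p ^ i)) = (p ^ i).totient)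
    (hp8 : p % 8 = 1 ∨ p % 8 = 7) : ∃ t, 2 ≡ g ^ (2 * t) [MOD p ^ i] := by
  have : Fact p.Prime := ⟨hp⟩
  obtain ⟨s, hs⟩ := exists_modEq_pow_of_orderOf_eq_totient (pow_pos hp.pos i) hg
    (x := 2) (hp2.pow.coprime_two_left)
  rcases Nat.even_or_odd' s with ⟨t, rfl | rfl⟩
  · exact ⟨t, hs⟩
  · exfalso
    have h1 : 2 ≡ g ^ (2 * t + 1) [MOD p] := hs.of_dvd (dvd_pow_self p (by lia))
    rw [← ZMod.natCast_eq_natCast_iff] at h1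
    push_cast at h1
    have hne : p ≠ 2 := by rintro rfl; simp at hp8
    obtain ⟨w, hw⟩ := (ZMod.exists_sq_eq_two_iff hne).2 hp8
    have hg0 : (g : ZMod p) ≠ 0 :=
      ((ZMod.isUnit_iff_coprime g p).2 (coprime_of_orderOf_eq_totient hp.pos hg1)).ne_zero
    refine not_isSquare_of_orderOf_eq_totient hp hp2 hg1 ⟨w / (g : ZMod p) ^ t, ?_⟩
    field_simp
    rw [sq w, ← hw, h1]
    ring

theorem isQuadratic_primePow {p i g : ℕ} (hp : p.Prime) (hp2 : Odd p) (hgo : Odd g) (hi : 1 ≤ i)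
    (hg1 : orderOf (g : ZMod p) = p.totient) (hg : orderOf (g : ZMod (p ^ i)) = (p ^ i).totient)
    (hp8 : p % 8 = 1 ∨ p % 8 = 7) :
    IsQuadratic g 1 (p ^ i) (p ^ (i - 1) * (p - 1) / 2) 1 where
  odd_left := hgo
  odd_right := odd_one
  odd_modulus := hp2.pow
  bounded t k := by
    have hev : Even (p ^ (i - 1) * (p - 1)) :=
      Even.mul_left (hp2.tsub_odd odd_one) _
    obtain ⟨r, hr⟩ := hev.two_dvd
    have hpos : 0 < p ^ (i - 1) * (p - 1) :=
      Nat.mul_pos (pow_pos hp.pos _) (by have := hp.two_le; lia)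
    have hr2 : p ^ (i - 1) * (p - 1) / 2 = r := by lia
    refine ⟨t % r, ?_, 0, one_pos, ?_⟩
    · rw [hr2]; exact Nat.mod_lt _ (by lia)
    · simp only [one_pow, mul_one]
      refine pow_modEq_pow_of_modEq_totient
        (coprime_of_orderOf_eq_totient (pow_pos hp.pos i) hg) ?_
      rw [Nat.totient_prime_pow hp hi, hr]
      exact (Nat.mod_modEq t r).mul_left' 2
  two := by
    obtain ⟨t, ht⟩ := two_modEq_even_pow hp hp2 hi hg1 hg hp8
    exact ⟨t, 0, by simpa using ht⟩
  cover x hx := by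
    obtain ⟨s, hs⟩ := exists_modEq_pow_of_orderOf_eq_totient (pow_pos hp.pos i) hg hx
    rcases Nat.even_or_odd' s with ⟨t, rfl | rfl⟩
    · exact Or.inl ⟨t, 0, by simpa using hs⟩
    · exact Or.inr ⟨t, 0, by simpa [pow_succ'] using hs⟩

theorem exists_modEq_pow_mul_pow {P Q g y z t r : ℕ} (hPQ : P.Coprime Q) (hP : 0 < P)
    (hg : g.Coprime P) (hyP : y ≡ g [MOD P]) (hyQ : y ≡ 1 [MOD Q])
    (hzP : z ≡ g ^ r [MOD P]) (hzQ : z ≡ g ^ t [MOD Q]) :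
    ∃ k, z ≡ g ^ t * y ^ k [MOD P * Q] := by
  obtain ⟨φ, hφ⟩ := Nat.exists_eq_succ_of_ne_zero (Nat.totient_pos.2 hP).ne'
  refine ⟨r + t * φ, ?_⟩
  rw [← Nat.modEq_and_modEq_iff_modEq_mul hPQ]
  constructor
  · refine hzP.trans (Nat.ModEq.trans ?_ ((hyP.pow (r + t * φ)).mul_left (g ^ t)).symm)
    rw [← pow_add]
    refine pow_modEq_pow_of_modEq_totient hg ?_
    rw [hφ, show t + (r + t * φ) = r + t * φ.succ by rw [Nat.succ_eq_add_one]; ring]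
    simp [Nat.ModEq]
  · refine hzQ.trans ?_
    simpa using ((hyQ.pow (r + t * φ)).mul_left (g ^ t)).symm

theorem isQuadratic_mul {p q i j g y : ℕ} (hp : p.Prime) (hq : q.Prime) (hpq : p ≠ q)
    (hp2 : Odd p) (hq2 : Odd q) (hgo : Odd g) (hyo : Odd y) (hi : 1 ≤ i) (hj : 1 ≤ j)
    (hgp1 : orderOf (g : ZMod p) = p.totient) (hgp : orderOf (g : ZMod (p ^ i)) = (p ^ i).totient)
    (hgq1 : orderOf (g : ZMod q) = q.totient) (hgq : orderOf (g : ZMod (q ^ j)) = (q ^ j).totient)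
    (hyp : y ≡ g [MOD p ^ i]) (hyq : y ≡ 1 [MOD q ^ j])
    (hp8 : p % 8 = 1 ∨ p % 8 = 7) (hq8 : q % 8 = 1 ∨ q % 8 = 7) :
    IsQuadratic g y (p ^ i * q ^ j) (dij p q i j / 2) (eij p q i j) := by
  have hP : 0 < p ^ i := pow_pos hp.pos i
  have hQ : 0 < q ^ j := pow_pos hq.pos j
  have hcop : (p ^ i).Coprime (q ^ j) := Nat.Coprime.pow _ _ ((Nat.coprime_primes hp hq).2 hpq)
  have hgP := coprime_of_orderOf_eq_totient hP hgp
  have hgQ := coprime_of_orderOf_eq_totient hQ hgq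
  refine ⟨hgo, hyo, hp2.pow.mul hq2.pow, fun t k => ?_, ?_, fun x hx => ?_⟩
  · have hd : dij p q i j = Nat.lcm (p ^ i).totient (q ^ j).totient := by
      rw [Nat.totient_prime_pow hp hi, Nat.totient_prime_pow hq hj]; rfl
    have he : eij p q i j = Nat.gcd (p ^ i).totient (q ^ j).totient := by
      rw [Nat.totient_prime_pow hp hi, Nat.totient_prime_pow hq hj]; rfl
    have hA := Nat.totient_pos.2 hP
    have hB := Nat.totient_pos.2 hQ
    have hBe : 2 ∣ (q ^ j).totient := by
      rw [Nat.totient_prime_pow hq hj]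
      exact (Even.mul_left (hq2.tsub_odd odd_one) _).two_dvd
    rw [hd, he]
    set A := (p ^ i).totient
    set B := (q ^ j).totient
    have hepos : 0 < A.gcd B := Nat.gcd_pos_of_pos_left _ hA
    obtain ⟨r, hr⟩ : 2 ∣ A.lcm B := hBe.trans (Nat.dvd_lcm_right A B)
    have hlpos : 0 < A.lcm B := Nat.lcm_pos hA hB
    have hr2 : A.lcm B / 2 = r := by lia
    obtain ⟨s, hs1, hs2⟩ := Nat.chineseRemainder' (n := A) (m := B)
      (a := A.gcd B * (k / A.gcd B)) (b := 0)
      (Nat.modEq_zero_iff_dvd.2 (dvd_mul_right _ _))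
    obtain ⟨s', rfl⟩ : 2 ∣ s := hBe.trans (Nat.modEq_zero_iff_dvd.1 hs2)
    have ht : 2 * ((t + s') % r) ≡ 2 * t + 2 * s' [MOD A.lcm B] := by
      rw [hr, ← mul_add]
      exact (Nat.mod_modEq (t + s') r).mul_left' 2
    refine ⟨(t + s') % r, hr2 ▸ Nat.mod_lt _ (by lia), k % A.gcd B, Nat.mod_lt _ hepos, ?_⟩
    rw [← Nat.modEq_and_modEq_iff_modEq_mul hcop]
    constructor
    · refine ((hyp.pow _).mul_left _).trans (Nat.ModEq.trans ?_ ((hyp.pow k).mul_left _).symm)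
      rw [← pow_add, ← pow_add]
      refine pow_modEq_pow_of_modEq_totient hgP ?_
      have h1 := ((ht.of_dvd (Nat.dvd_lcm_left A B)).trans (hs1.add_left (2 * t))).add_right
        (k % A.gcd B)
      rwa [add_assoc, Nat.div_add_mod] at h1
    · refine ((hyq.pow _).mul_left _).trans (Nat.ModEq.trans ?_ ((hyq.pow k).mul_left _).symm)
      simp only [one_pow, mul_one]
      exact pow_modEq_pow_of_modEq_totient hgQ
        ((ht.of_dvd (Nat.dvd_lcm_right A B)).trans (hs2.add_left (2 * t)))
  · obtain ⟨t, ht⟩ := two_modEq_even_pow hq hq2 hj hgq1 hgq hq8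
    obtain ⟨r, hr⟩ := two_modEq_even_pow hp hp2 hi hgp1 hgp hp8
    exact ⟨t, exists_modEq_pow_mul_pow hcop hP hgP hyp hyq hr ht⟩
  · obtain ⟨r, hr⟩ := exists_modEq_pow_of_orderOf_eq_totient hP hgp hx.coprime_mul_right_right
    obtain ⟨s, hs⟩ := exists_modEq_pow_of_orderOf_eq_totient hQ hgq hx.coprime_mul_left_right
    obtain ⟨k, hk⟩ := exists_modEq_pow_mul_pow hcop hP hgP hyp hyq hr hs
    rcases Nat.even_or_odd' s with ⟨t, rfl | rfl⟩
    · exact Or.inl ⟨t, k, by simpa using hk⟩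
    · exact Or.inr ⟨t, k, by simpa [pow_succ', mul_assoc] using hk⟩

end PrimePower

/-- Every positive integer is `p ^ (m - i) * x` with `i ≤ m`, where `p ∤ x` unless `i = 0`. -/
theorem exists_eq_prime_pow_mul {p : ℕ} (hp : p.Prime) (m : ℕ) {u : ℕ} (hu : u ≠ 0) :
    ∃ i ≤ m, ∃ x, u = p ^ (m - i) * x ∧ (1 ≤ i → x.Coprime p) := by
  obtain ⟨a, x, hx, rfl⟩ := Nat.exists_eq_pow_mul_and_not_dvd hu p hp.ne_one
  rcases le_total m a with h | h
  · refine ⟨0, Nat.zero_le _, p ^ (a - m) * x, ?_, by lia⟩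
    rw [← mul_assoc, ← pow_add]
    congr 2
    lia
  · refine ⟨m - a, by lia, x, ?_, fun _ => ((Nat.Prime.coprime_iff_not_dvd hp).2 hx).symm⟩
    rw [show m - (m - a) = a by lia]

theorem F4_sum_eq_zero {a b c d : F4} (hab : a ≠ b) (hac : a ≠ c) (had : a ≠ d) (hbc : b ≠ c)
    (hbd : b ≠ d) (hcd : c ≠ d) : a + b + c + d = 0 := by
  classical
  have : Fintype F4 := Fintype.ofFinite F4
  have hcard : Fintype.card F4 = 4 := by
    rw [← Nat.card_eq_fintype_card, GaloisField.card 2 2 (by norm_num)]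
    norm_num
  have huniv : ({a, b, c, d} : Finset F4) = Finset.univ := by
    apply Finset.eq_univ_of_card
    rw [hcard]
    simp [Finset.card_insert_of_notMem, *]
  have hsum := FiniteField.sum_pow_lt_card_sub_one F4 1 (by rw [hcard]; norm_num)
  rw [← huniv] at hsum
  simp only [pow_one] at hsum
  rw [Finset.sum_insert (by simp [*]), Finset.sum_insert (by simp [*]),
    Finset.sum_insert (by simp [*]), Finset.sum_singleton] at hsum
  rw [← hsum]
  ring

theorem statement11
    (p q m n g y : ℕ)
    (hp : p.Prime) (hq : q.Prime) (hpq : p ≠ q) (hpodd : Odd p) (hqodd : Odd q)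
    (hm : 1 ≤ m) (hn : 1 ≤ n) (hgodd : Odd g)
    (hgp : ∀ i, 1 ≤ i → i ≤ m → orderOf (g : ZMod (p ^ i)) = Nat.totient (p ^ i))
    (hg2p : ∀ i, 1 ≤ i → i ≤ m → orderOf (g : ZMod (2 * p ^ i)) = Nat.totient (2 * p ^ i))
    (hgq : ∀ j, 1 ≤ j → j ≤ n → orderOf (g : ZMod (q ^ j)) = Nat.totient (q ^ j))
    (hg2q : ∀ j, 1 ≤ j → j ≤ n → orderOf (g : ZMod (2 * q ^ j)) = Nat.totient (2 * q ^ j))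
    (hylt : y < 2 * (p ^ m * q ^ n))
    (hyg : y ≡ g [MOD 2 * p ^ m]) (hy1 : y ≡ 1 [MOD 2 * q ^ n])
    (a b c d e : F4)
    (hab : a ≠ b) (hac : a ≠ c) (had : a ≠ d) (hbc : b ≠ c) (hbd : b ≠ d) (hcd : c ≠ d)
    (he : e ≠ 0)
    (K : Type*) [Field K] [Fintype K] [Algebra F4 K]
    (hK : Fintype.card K = 4 ^ orderOf (4 : ZMod (p ^ m * q ^ n)))
    (β : K) (hβ : IsPrimitiveRoot β (p ^ m * q ^ n))
    (hp8 : p % 8 = 1 ∨ p % 8 = 7) (hq8 : q % 8 = 1 ∨ q % 8 = 7) :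
    ∀ k, 1 ≤ k → k ≤ p ^ m * q ^ n - 1 →
      Polynomial.aeval (β ^ k) (genPoly p q m n g y a b c d e)
        = algebraMap F4 K (e + b + d) := by
  have hgp1 : orderOf (g : ZMod p) = p.totient := pow_one p ▸ hgp 1 le_rfl hm
  have hgq1 : orderOf (g : ZMod q) = q.totient := pow_one q ▸ hgq 1 le_rfl hn
  have hyodd : Odd y := Nat.odd_iff.2 (hy1.of_mul_right (q ^ n))
  have hPQ : ∀ i ∈ Icc 1 m, ∀ j ∈ Icc 1 n,
      IsQuadratic g y (p ^ i * q ^ j) (dij p q i j / 2) (eij p q i j) := by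
    intro i hi j hj
    rw [mem_Icc] at hi hj
    exact isQuadratic_mul hp hq hpq hpodd hqodd hgodd hyodd hi.1 hj.1 hgp1 (hgp i hi.1 hi.2)
      hgq1 (hgq j hj.1 hj.2) ((hyg.of_mul_left 2).of_dvd (pow_dvd_pow p hi.2))
      ((hy1.of_mul_left 2).of_dvd (pow_dvd_pow q hj.2)) hp8 hq8
  have hP : ∀ i ∈ Icc 1 m, IsQuadratic g 1 (p ^ i) (p ^ (i - 1) * (p - 1) / 2) 1 := by
    intro i hi
    rw [mem_Icc] at hi
    exact isQuadratic_primePow hp hpodd hgodd hi.1 hgp1 (hgp i hi.1 hi.2) hp8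
  have hQ : ∀ j ∈ Icc 1 n, IsQuadratic g 1 (q ^ j) (q ^ (j - 1) * (q - 1) / 2) 1 := by
    intro j hj
    rw [mem_Icc] at hj
    exact isQuadratic_primePow hq hqodd hgodd hj.1 hgq1 (hgq j hj.1 hj.2) hq8
  have hpm : ∀ i ≤ m, p ^ (m - i) * p ^ i = p ^ m := fun i hi => by
    rw [← pow_add, Nat.sub_add_cancel hi]
  have hqn : ∀ j ≤ n, q ^ (n - j) * q ^ j = q ^ n := fun j hj => by
    rw [← pow_add, Nat.sub_add_cancel hj]
  have cPQ : ∀ i ≤ m, ∀ j ≤ n,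
      p ^ (m - i) * q ^ (n - j) * (p ^ i * q ^ j) = p ^ m * q ^ n := fun i hi j hj => by
    rw [mul_mul_mul_comm, hpm i hi, hqn j hj]
  have cP : ∀ i ≤ m, p ^ (m - i) * q ^ n * p ^ i = p ^ m * q ^ n := fun i hi => by
    rw [mul_right_comm, hpm i hi]
  have cQ : ∀ j ≤ n, p ^ m * q ^ (n - j) * q ^ j = p ^ m * q ^ n := fun j hj => by
    rw [mul_assoc, hqn j hj]
  have hMpos : 0 < p ^ m * q ^ n := Nat.mul_pos (pow_pos hp.pos _) (pow_pos hq.pos _)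
  have hModd : Odd (p ^ m * q ^ n) := hpodd.pow.mul hqodd.pow
  have odd_of_mem : ∀ h u, u ∈ UnionH p q m n g y h → Odd u := by
    intro h u hu
    simp only [UnionH, mem_union, mem_biUnion] at hu
    rcases hu with (⟨i, hi, j, hj, hu⟩ | ⟨i, hi, hu⟩) | ⟨j, hj, hu⟩
    · exact (hPQ i hi j hj).odd_of_mem_scaled (hpodd.pow.mul hqodd.pow) hu
    · exact (hP i hi).odd_of_mem_scaled (hpodd.pow.mul hqodd.pow) hu
    · exact (hQ j hj).odd_of_mem_scaled (hpodd.pow.mul hqodd.pow) hu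
  have mem_iff : ∀ h u v, Odd u → Even v → u < 2 * (p ^ m * q ^ n) → v < 2 * (p ^ m * q ^ n) →
      u ≡ v [MOD p ^ m * q ^ n] →
      (u ∈ UnionH p q m n g y h ↔ v ∈ Union2H p q m n g y h) := by
    intro h u v hu hv hul hvl huv
    simp only [UnionH, Union2H, mem_union, mem_biUnion]
    refine or_congr (or_congr ?_ ?_) ?_
    · refine exists_congr fun i => and_congr_right fun hi => exists_congr fun j =>
        and_congr_right fun hj => ?_
      have h1 := cPQ i (mem_Icc.1 hi).2 j (mem_Icc.1 hj).2
      exact (hPQ i hi j hj).mem_scaled_iff hu hv (h1 ▸ hul) (h1 ▸ hvl) (h1 ▸ huv)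
    · refine exists_congr fun i => and_congr_right fun hi => ?_
      have h1 := cP i (mem_Icc.1 hi).2
      exact (hP i hi).mem_scaled_iff hu hv (h1 ▸ hul) (h1 ▸ hvl) (h1 ▸ huv)
    · refine exists_congr fun j => and_congr_right fun hj => ?_
      have h1 := cQ j (mem_Icc.1 hj).2
      exact (hQ j hj).mem_scaled_iff hu hv (h1 ▸ hul) (h1 ▸ hvl) (h1 ▸ huv)
  have cover : ∀ u, Odd u → u < 2 * (p ^ m * q ^ n) → u ≠ p ^ m * q ^ n →
      u ∈ UnionH p q m n g y 0 ∨ u ∈ UnionH p q m n g y 1 := by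
    intro u hu hul hne
    obtain ⟨i, hi, x, rfl, hx⟩ := exists_eq_prime_pow_mul hp m hu.pos.ne'
    have hxo := (Nat.odd_mul.1 hu).2
    obtain ⟨j, hj, z, rfl, hz⟩ := exists_eq_prime_pow_mul hq n hxo.pos.ne'
    have hzo := (Nat.odd_mul.1 hxo).2
    rw [← mul_assoc] at hul hne ⊢
    have hzl : z < 2 * (p ^ i * q ^ j) := by
      rw [← cPQ i hi j hj, mul_left_comm] at hul
      exact lt_of_mul_lt_mul_left hul (Nat.zero_le _)
    have hzp : z.Coprime (p ^ i) := by
      rcases Nat.eq_zero_or_pos i with rfl | hi0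
      · simp
      · exact (hx hi0).coprime_mul_left.pow_right i
    have hzq : z.Coprime (q ^ j) := by
      rcases Nat.eq_zero_or_pos j with rfl | hj0
      · simp
      · exact (hz hj0).pow_right j
    simp only [UnionH, mem_union, mem_biUnion]
    rcases Nat.eq_zero_or_pos i with rfl | hi0 <;> rcases Nat.eq_zero_or_pos j with rfl | hj0
    · exfalso
      simp only [pow_zero, mul_one] at hzl
      have : z = 1 := by
        obtain ⟨r, hr⟩ := hzo
        lia
      simp [this] at hne
    · have hj' := mem_Icc.2 ⟨hj0, hj⟩
      exact ((hQ j hj').mem_scaled_or hzo (by simpa using hzl) hzq).imp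
        (fun h => Or.inr ⟨j, hj', h⟩) (fun h => Or.inr ⟨j, hj', h⟩)
    · have hi' := mem_Icc.2 ⟨hi0, hi⟩
      exact ((hP i hi').mem_scaled_or hzo (by simpa using hzl) hzp).imp
        (fun h => Or.inl (Or.inr ⟨i, hi', h⟩)) (fun h => Or.inl (Or.inr ⟨i, hi', h⟩))
    · have hi' := mem_Icc.2 ⟨hi0, hi⟩
      have hj' := mem_Icc.2 ⟨hj0, hj⟩
      exact ((hPQ i hi' j hj').mem_scaled_or hzo hzl (hzp.mul_right hzq)).imp
        (fun h => Or.inl (Or.inl ⟨i, hi', j, hj', h⟩))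
        (fun h => Or.inl (Or.inl ⟨i, hi', j, hj', h⟩))
  have habcd := F4_sum_eq_zero hab hac had hbc hbd hcd
  have hac_bd : a + c = b + d := by
    have h2 : b + d + (b + d) = 0 := CharTwo.add_self_eq_zero _
    linear_combination habcd - h2
  have pair : ∀ u v, Odd u → Even v → u < 2 * (p ^ m * q ^ n) → v < 2 * (p ^ m * q ^ n) →
      u ≠ p ^ m * q ^ n → v ≠ 0 → u ≡ v [MOD p ^ m * q ^ n] →
      seqS p q m n g y a b c d e u + seqS p q m n g y a b c d e v = b + d := by
    intro u v hu hv hul hvl hune hv0 huv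
    have hvH : ∀ h, v ∉ UnionH p q m n g y h := fun h hmem =>
      Nat.not_even_iff_odd.2 (odd_of_mem h v hmem) hv
    have hvne : v ≠ p ^ m * q ^ n := by
      rintro rfl
      exact Nat.not_even_iff_odd.2 hModd hv
    have h0 := mem_iff 0 u v hu hv hul hvl huv
    have h1 := mem_iff 1 u v hu hv hul hvl huv
    simp only [seqS, Nat.mod_eq_of_lt hul, Nat.mod_eq_of_lt hvl, hu.pos.ne', hune, hv0, hvne,
      hvH, if_false]
    by_cases hm0 : u ∈ UnionH p q m n g y 0
    · simpa [hm0, h0.1 hm0] using hac_bd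
    · have hm1 := (cover u hu hul hune).resolve_left hm0
      simp [hm0, hm1, h1.1 hm1, mt h0.2 hm0]
  intro k hk1 hk2
  set M := p ^ m * q ^ n with hM
  set s := seqS p q m n g y a b c d e with hs
  have hs0 : s 0 + s M = e := by
    have h1 : M % (2 * M) = M := Nat.mod_eq_of_lt (by lia)
    simp [hs, seqS, ← hM, h1, hMpos.ne']
  have hsv : ∀ v ∈ Finset.range M, v ≠ 0 → s v + s (M + v) = b + d := by
    intro v hv hv0
    rw [Finset.mem_range] at hv
    rcases Nat.even_or_odd v with hev | hodd
    · rw [add_comm]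
      exact pair (M + v) v (hModd.add_even hev) hev (by lia) (by lia) (by lia) hv0
        (by simp [Nat.ModEq])
    · exact pair v (M + v) hodd (hModd.add_odd hodd) (by lia) (by lia) (by lia) (by lia)
        (by simp [Nat.ModEq])
  have hζ : (β ^ k) ^ M = 1 := by rw [← pow_mul, mul_comm, pow_mul, hβ.pow_eq_one, one_pow]
  have hζ1 : β ^ k ≠ 1 := hβ.pow_ne_one_of_pos_of_lt (by lia) (by lia)
  have hgeom : ∑ v ∈ Finset.range M, (β ^ k) ^ v = 0 := by
    have h1 := geom_sum_mul (β ^ k) M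
    rw [hζ, sub_self] at h1
    exact (mul_eq_zero.1 h1).resolve_right (sub_ne_zero.2 hζ1)
  have hsum : Polynomial.aeval (β ^ k) (genPoly p q m n g y a b c d e) =
      ∑ v ∈ Finset.range M, algebraMap F4 K (s v + s (M + v)) * (β ^ k) ^ v := by
    simp only [genPoly, ← hM, ← hs, map_sum, map_mul, Polynomial.aeval_C, map_pow,
      Polynomial.aeval_X]
    rw [two_mul, Finset.sum_range_add, ← Finset.sum_add_distrib]
    refine Finset.sum_congr rfl fun v _ => ?_
    rw [pow_add, hζ, map_add]
    ring
  have hterm : ∀ v ∈ Finset.range M, algebraMap F4 K (s v + s (M + v)) * (β ^ k) ^ v =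
      algebraMap F4 K (b + d) * (β ^ k) ^ v +
        if v = 0 then algebraMap F4 K (e + b + d) else 0 := by
    intro v hv
    split_ifs with h0
    · subst h0
      rw [add_zero, hs0, pow_zero, mul_one, mul_one, ← map_add]
      congr 1
      have h2 : b + d + (b + d) = 0 := CharTwo.add_self_eq_zero _
      linear_combination -h2
    · rw [hsv v hv h0, add_zero]
  rw [hsum, Finset.sum_congr rfl hterm, Finset.sum_add_distrib, ← Finset.mul_sum, hgeom,
    Finset.sum_ite_eq', if_pos (Finset.mem_range.2 hMpos)]
  simp

end
end

section
/- Suppose p ≡ ±3 (mod 8) and q ≡ ±3 (mod 8). Then for every integer k with 1 ≤ k ≤ p^m q^n − 1, the generating polynomial of the quaternary generalized cyclotomic sequence S satisfies S(β^k) = e + b + c in F_{4^{d*}}. -/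
open Finset Polynomial

noncomputable section

open scoped NumberTheorySymbols

/-- A residue whose order modulo `P` is `φ(P)` generates all units modulo `P`. -/
lemma exists_pow_modEq_of_orderOf_eq_totient {P g z : ℕ} [NeZero P]
    (hg : orderOf (g : ZMod P) = Nat.totient P) (hz : z.Coprime P) :
    ∃ A, g ^ A ≡ z [MOD P] := by
  have hfin : IsOfFinOrder (g : ZMod P) := by
    rw [← orderOf_pos_iff, hg]
    exact Nat.totient_pos.2 (NeZero.pos P)
  obtain ⟨u, hu⟩ := hfin.isUnit
  have hcard : Nat.card (Subgroup.zpowers u) = Nat.card (ZMod P)ˣ := by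
    rw [Nat.card_zpowers, ← orderOf_units, hu, hg, Nat.card_eq_fintype_card,
      ZMod.card_units_eq_totient]
  have hmem : ZMod.unitOfCoprime z hz ∈ Subgroup.zpowers u := by
    rw [Subgroup.eq_top_of_card_eq _ hcard]
    trivial
  obtain ⟨A, hA⟩ := mem_powers_iff_mem_zpowers.2 hmem
  refine ⟨A, (ZMod.natCast_eq_natCast_iff _ _ _).1 ?_⟩
  have := congrArg Units.val hA
  simpa [hu] using this

lemma pow_modEq_pow_of_orderOf {P g φ s t : ℕ} (hg : orderOf (g : ZMod P) = φ)
    (h : s ≡ t [MOD φ]) : g ^ s ≡ g ^ t [MOD P] := by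
  rw [← ZMod.natCast_eq_natCast_iff]
  push_cast
  exact pow_eq_pow_of_modEq h (hg ▸ pow_orderOf_eq_one _)

/-- A primitive root modulo an odd prime is a quadratic nonresidue. -/
lemma jacobiSym_eq_neg_one_of_orderOf {p g : ℕ} (hp : p.Prime) (hodd : Odd p)
    (hg : orderOf (g : ZMod p) = p - 1) : J((g : ℤ) | p) = -1 := by
  have := Fact.mk hp
  have hp2 : p ≠ 2 := by rintro rfl; exact absurd hodd (by decide)
  have h3 := hp.two_le
  have hg0 : (g : ZMod p) ≠ 0 := by
    intro h
    rw [h, orderOf_zero] at hg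
    omega
  rw [← jacobiSym.legendreSym.to_jacobiSym]
  rcases legendreSym.eq_one_or_neg_one p (a := (g : ℤ)) (by simpa using hg0) with h | h
  · exfalso
    have h1 := legendreSym.eq_pow p (g : ℤ)
    rw [h] at h1
    have h2 := orderOf_dvd_of_pow_eq_one (x := (g : ZMod p)) (n := p / 2) (by simpa using h1.symm)
    rw [hg] at h2
    have := Nat.le_of_dvd (by omega) h2
    omega
  · exact h

lemma jacobiSym_congr {r a b : ℕ} (h : a ≡ b [MOD r]) : J((a : ℤ) | r) = J((b : ℤ) | r) :=
  jacobiSym.mod_left' (by exact_mod_cast h)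

lemma jacobiSym_two_eq_neg_one {p : ℕ} (h : p % 8 = 3 ∨ p % 8 = 5) : J(2 | p) = -1 := by
  have hodd : Odd p := by rw [Nat.odd_iff]; omega
  rw [jacobiSym.at_two hodd, ZMod.χ₈_nat_eq_if_mod_eight]
  rw [if_neg (by omega), if_neg (by omega)]

/-- Membership in a generalized cyclotomic class is detected by a quadratic character. -/
lemma mem_GC_iff {r N g y dHalf e h z : ℕ} (hN : 0 < N) (hrN : r ∣ N)
    (hgN : g.Coprime N) (hyN : y.Coprime N)
    (hg : J((g : ℤ) | r) = -1) (hy : J((y : ℤ) | r) = 1)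
    (hcov : ∀ z, z.Coprime N → ∃ s < 2 * dHalf, ∃ k < e, g ^ s * y ^ k ≡ z [MOD N])
    (hh : h = 0 ∨ h = 1) :
    z ∈ GC h g y N dHalf e ↔ z < N ∧ z.Coprime N ∧ J((z : ℤ) | r) = (-1) ^ h := by
  have hchar : ∀ s k z, g ^ s * y ^ k ≡ z [MOD N] → z.Coprime N ∧ J((z : ℤ) | r) = (-1) ^ s := by
    intro s k z hz
    constructor
    · have : Nat.Coprime (g ^ s * y ^ k) N := (hgN.pow_left s).mul_left (hyN.pow_left k)
      rw [Nat.Coprime, ← hz.gcd_eq]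
      exact this
    · rw [← jacobiSym_congr (hz.of_dvd hrN)]
      push_cast
      rw [jacobiSym.mul_left, jacobiSym.pow_left, jacobiSym.pow_left, hg, hy, one_pow, mul_one]
  rcases hh with rfl | rfl
  · simp only [GC, if_pos, GC0, mem_image, mem_product, mem_range, Prod.exists]
    constructor
    · rintro ⟨t, k, -, rfl⟩
      have := hchar (2 * t) k _ (Nat.mod_modEq _ _).symm
      exact ⟨Nat.mod_lt _ hN, this.1, by rw [this.2, pow_mul]; simp⟩
    · rintro ⟨hlt, hco, hJ⟩
      obtain ⟨s, hs, k, hk, hz⟩ := hcov z hco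
      have h2 := (hchar s k z hz).2
      rcases Nat.even_or_odd' s with ⟨t, rfl | rfl⟩
      · refine ⟨t, k, ⟨by omega, hk⟩, ?_⟩
        rw [hz, Nat.mod_eq_of_lt hlt]
      · rw [hJ, pow_succ, pow_mul] at h2
        norm_num at h2
  · simp only [GC, one_ne_zero, if_false, GC1, GC0, mem_image, mem_product, mem_range, Prod.exists]
    have hstep : ∀ t k, g * (g ^ (2 * t) * y ^ k % N) ≡ g ^ (2 * t + 1) * y ^ k [MOD N] := by
      intro t k
      rw [pow_succ, mul_comm (g ^ (2 * t)) g, mul_assoc]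
      exact (Nat.mod_modEq _ _).mul_left g
    constructor
    · rintro ⟨_, ⟨t, k, -, rfl⟩, rfl⟩
      have := hchar (2 * t + 1) k _ ((Nat.mod_modEq _ _).trans (hstep t k)).symm
      exact ⟨Nat.mod_lt _ hN, this.1, by rw [this.2, pow_succ, pow_mul]; simp⟩
    · rintro ⟨hlt, hco, hJ⟩
      obtain ⟨s, hs, k, hk, hz⟩ := hcov z hco
      have h2 := (hchar s k z hz).2
      rcases Nat.even_or_odd' s with ⟨t, rfl | rfl⟩
      · rw [hJ, pow_mul] at h2
        norm_num at h2
      · refine ⟨_, ⟨t, k, ⟨by omega, hk⟩, rfl⟩, ?_⟩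
        rw [(hstep t k).trans hz, Nat.mod_eq_of_lt hlt]

/-- A common primitive root `g` of `P` and `Q`, together with `y ≡ (g, 1)`, generates the units
modulo `P * Q`, with exponents in Whiteman's range. -/
lemma exists_pow_mul_pow_modEq {P Q g y φP φQ z : ℕ} [NeZero P] [NeZero Q]
    (hPQ : P.Coprime Q) (hgP : orderOf (g : ZMod P) = φP) (hgQ : orderOf (g : ZMod Q) = φQ)
    (hφP : φP = P.totient) (hφQ : φQ = Q.totient)
    (hyP : y ≡ g [MOD P]) (hyQ : y ≡ 1 [MOD Q]) (hz : z.Coprime (P * Q)) :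
    ∃ s < Nat.lcm φP φQ, ∃ k < Nat.gcd φP φQ, g ^ s * y ^ k ≡ z [MOD P * Q] := by
  have hP0 : 0 < φP := hφP ▸ Nat.totient_pos.2 (NeZero.pos P)
  have hQ0 : 0 < φQ := hφQ ▸ Nat.totient_pos.2 (NeZero.pos Q)
  obtain ⟨A, hA⟩ := exists_pow_modEq_of_orderOf_eq_totient (hgP.trans hφP)
    (hz.coprime_dvd_right (dvd_mul_right P Q))
  obtain ⟨B, hB⟩ := exists_pow_modEq_of_orderOf_eq_totient (hgQ.trans hφQ)
    (hz.coprime_dvd_right (dvd_mul_left Q P))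
  set e := Nat.gcd φP φQ with he
  have he0 : 0 < e := Nat.gcd_pos_of_pos_left _ hP0
  obtain ⟨A', hA', hle⟩ : ∃ A', A' ≡ A [MOD φP] ∧ B ≤ A' := by
    refine ⟨A + φP * B, by simp [Nat.ModEq], ?_⟩
    nlinarith
  have hk : (A' - B) % e < e := Nat.mod_lt _ he0
  have hkle : (A' - B) % e ≤ A' - B := Nat.mod_le _ _
  have hmod : A' - (A' - B) % e ≡ B [MOD e] := by
    have h1 := Nat.div_add_mod (A' - B) e
    have : A' - (A' - B) % e = B + e * ((A' - B) / e) := by omega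
    rw [this]
    simp [Nat.ModEq]
  obtain ⟨s, hs, hs1, hs2⟩ : ∃ s < Nat.lcm φP φQ,
      s ≡ A' - (A' - B) % e [MOD φP] ∧ s ≡ B [MOD φQ] :=
    ⟨Nat.chineseRemainder' hmod, Nat.chineseRemainder'_lt_lcm hmod hP0.ne' hQ0.ne',
      (Nat.chineseRemainder' hmod).2.1, (Nat.chineseRemainder' hmod).2.2⟩
  refine ⟨s, hs, (A' - B) % e, hk, ?_⟩
  rw [← Nat.modEq_and_modEq_iff_modEq_mul hPQ]
  constructor
  · have h1 : g ^ s * y ^ ((A' - B) % e) ≡ g ^ (A' - (A' - B) % e) * g ^ ((A' - B) % e) [MOD P] :=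
      (pow_modEq_pow_of_orderOf hgP hs1).mul (hyP.pow _)
    rw [← pow_add, Nat.sub_add_cancel (hkle.trans (Nat.sub_le _ _))] at h1
    exact h1.trans ((pow_modEq_pow_of_orderOf hgP hA').trans hA)
  · have h1 : g ^ s * y ^ ((A' - B) % e) ≡ g ^ B * 1 ^ ((A' - B) % e) [MOD Q] :=
      (pow_modEq_pow_of_orderOf hgQ hs2).mul (hyQ.pow _)
    rw [one_pow, mul_one] at h1
    exact h1.trans hB

/-- Lifting a congruence between odd numbers along an odd modulus to twice the modulus. -/
lemma modEq_mul_of_odd {ε N a b : ℕ} (hε : ε = 1 ∨ ε = 2) (hN : Odd N) (ha : Odd a)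
    (hb : b.Coprime ε) (h : a ≡ b [MOD N]) : a ≡ b [MOD ε * N] := by
  rcases hε with rfl | rfl
  · simpa using h
  · rw [← Nat.modEq_and_modEq_iff_modEq_mul (Nat.coprime_two_left.2 hN)]
    refine ⟨?_, h⟩
    rw [Nat.coprime_two_right] at hb
    rw [Nat.ModEq, Nat.odd_iff.1 ha, Nat.odd_iff.1 hb]

lemma coprime_of_jacobiSym_ne_zero {r a : ℕ} (hr : r ≠ 0) (h : J((a : ℤ) | r) ≠ 0) :
    a.Coprime r := by
  by_contra hc
  exact h (jacobiSym.eq_zero_iff.2 ⟨hr, by simpa [Int.gcd_natCast_natCast] using hc⟩)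

/-- The standing hypotheses on the moduli, the common primitive root `g` and the residue `y`. -/
structure CyclotomicSetup (p q m n g y : ℕ) : Prop where
  hp : p.Prime
  hq : q.Prime
  hpq : p ≠ q
  hpodd : Odd p
  hqodd : Odd q
  hm : 1 ≤ m
  hn : 1 ≤ n
  hgodd : Odd g
  hyodd : Odd y
  hgp : ∀ i, 1 ≤ i → i ≤ m → orderOf (g : ZMod (p ^ i)) = Nat.totient (p ^ i)
  hgq : ∀ j, 1 ≤ j → j ≤ n → orderOf (g : ZMod (q ^ j)) = Nat.totient (q ^ j)
  hyp : y ≡ g [MOD p ^ m]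
  hyq : y ≡ 1 [MOD q ^ n]

lemma even_pow_mul_pred {p : ℕ} (hodd : Odd p) (i : ℕ) : Even (p ^ i * (p - 1)) := by
  rw [Nat.even_mul]
  exact Or.inr (Nat.Odd.sub_odd hodd odd_one)

namespace CyclotomicSetup

variable {p q m n g y : ℕ}

lemma jacobi_g_p (S : CyclotomicSetup p q m n g y) : J((g : ℤ) | p) = -1 := by
  refine jacobiSym_eq_neg_one_of_orderOf S.hp S.hpodd ?_
  have := S.hgp 1 le_rfl S.hm
  rwa [pow_one, Nat.totient_prime S.hp] at this

lemma jacobi_g_q (S : CyclotomicSetup p q m n g y) : J((g : ℤ) | q) = -1 := by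
  refine jacobiSym_eq_neg_one_of_orderOf S.hq S.hqodd ?_
  have := S.hgq 1 le_rfl S.hn
  rwa [pow_one, Nat.totient_prime S.hq] at this

lemma jacobi_y_p (S : CyclotomicSetup p q m n g y) : J((y : ℤ) | p) = -1 := by
  rw [← S.jacobi_g_p]
  exact jacobiSym_congr (S.hyp.of_dvd (dvd_pow_self p (Nat.one_le_iff_ne_zero.1 S.hm)))

lemma jacobi_y_q (S : CyclotomicSetup p q m n g y) : J((y : ℤ) | q) = 1 := by
  rw [jacobiSym_congr (S.hyq.of_dvd (dvd_pow_self q (Nat.one_le_iff_ne_zero.1 S.hn)))]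
  simp

lemma coprime_pow (S : CyclotomicSetup p q m n g y) (i j : ℕ) : (p ^ i).Coprime (q ^ j) :=
  Nat.Coprime.pow i j ((Nat.coprime_primes S.hp S.hq).2 S.hpq)

lemma coprime_of_odd {ε x : ℕ} (hε : ε = 1 ∨ ε = 2)
    (hx : Odd x) (hxp : x.Coprime p) (hxq : x.Coprime q) (i j : ℕ) :
    x.Coprime (ε * (p ^ i * q ^ j)) := by
  refine Nat.Coprime.mul_right ?_ ((hxp.pow_right i).mul_right (hxq.pow_right j))
  rcases hε with rfl | rfl
  · simp
  · rwa [Nat.coprime_two_right]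

lemma g_coprime (S : CyclotomicSetup p q m n g y) {ε : ℕ} (hε : ε = 1 ∨ ε = 2) (i j : ℕ) :
    g.Coprime (ε * (p ^ i * q ^ j)) :=
  coprime_of_odd hε S.hgodd
    (coprime_of_jacobiSym_ne_zero S.hp.ne_zero (by simp [S.jacobi_g_p]))
    (coprime_of_jacobiSym_ne_zero S.hq.ne_zero (by simp [S.jacobi_g_q])) i j

lemma y_coprime (S : CyclotomicSetup p q m n g y) {ε : ℕ} (hε : ε = 1 ∨ ε = 2) (i j : ℕ) :
    y.Coprime (ε * (p ^ i * q ^ j)) :=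
  coprime_of_odd hε S.hyodd
    (coprime_of_jacobiSym_ne_zero S.hp.ne_zero (by simp [S.jacobi_y_p]))
    (coprime_of_jacobiSym_ne_zero S.hq.ne_zero (by simp [S.jacobi_y_q])) i j

lemma modulus_pos (S : CyclotomicSetup p q m n g y) {ε : ℕ} (hε : ε = 1 ∨ ε = 2) (i j : ℕ) :
    0 < ε * (p ^ i * q ^ j) := by
  have := S.hp.pos
  have := S.hq.pos
  have : 0 < ε := by omega
  positivity

lemma odd_modulus (S : CyclotomicSetup p q m n g y) (i j : ℕ) : Odd (p ^ i * q ^ j) :=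
  S.hpodd.pow.mul S.hqodd.pow

lemma mem_GC_pq (S : CyclotomicSetup p q m n g y) {ε h i j z : ℕ} (hε : ε = 1 ∨ ε = 2)
    (hh : h = 0 ∨ h = 1) (hi : 1 ≤ i) (him : i ≤ m) (hj : 1 ≤ j) (hjn : j ≤ n) :
    z ∈ GC h g y (ε * (p ^ i * q ^ j)) (dij p q i j / 2) (eij p q i j) ↔
      z < ε * (p ^ i * q ^ j) ∧ z.Coprime (ε * (p ^ i * q ^ j)) ∧ J((z : ℤ) | q) = (-1) ^ h := by
  have : NeZero (p ^ i) := ⟨pow_ne_zero _ S.hp.ne_zero⟩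
  have : NeZero (q ^ j) := ⟨pow_ne_zero _ S.hq.ne_zero⟩
  have hφp := Nat.totient_prime_pow S.hp hi
  have hφq := Nat.totient_prime_pow S.hq hj
  have hd : dij p q i j = Nat.lcm (p ^ (i - 1) * (p - 1)) (q ^ (j - 1) * (q - 1)) := rfl
  have hdeven : 2 ∣ dij p q i j := by
    rw [hd]
    exact (even_pow_mul_pred S.hpodd _).two_dvd.trans (Nat.dvd_lcm_left _ _)
  refine mem_GC_iff (S.modulus_pos hε i j)
    ((dvd_pow_self q (by omega)).trans ((dvd_mul_left _ _).trans (dvd_mul_left _ _)))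
    (S.g_coprime hε i j) (S.y_coprime hε i j) S.jacobi_g_q S.jacobi_y_q ?_ hh
  intro z hz
  obtain ⟨s, hs, k, hk, hsk⟩ := exists_pow_mul_pow_modEq (S.coprime_pow i j)
    ((S.hgp i hi him).trans hφp) ((S.hgq j hj hjn).trans hφq) hφp.symm hφq.symm
    (S.hyp.of_dvd (pow_dvd_pow p him)) (S.hyq.of_dvd (pow_dvd_pow q hjn))
    (hz.coprime_dvd_right (dvd_mul_left _ ε))
  refine ⟨s, by rwa [Nat.mul_div_cancel' hdeven, hd], k, hk, ?_⟩
  exact modEq_mul_of_odd hε (S.odd_modulus i j) (S.hgodd.pow.mul S.hyodd.pow)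
    (hz.coprime_dvd_right (dvd_mul_right _ _)) hsk

end CyclotomicSetup

/-- The single prime power analogue of `CyclotomicSetup.mem_GC_pq`. -/
lemma mem_GC_prime_pow {p g ε h i z : ℕ} (hp : p.Prime) (hodd : Odd p) (hgodd : Odd g)
    (hJ : J((g : ℤ) | p) = -1) (hε : ε = 1 ∨ ε = 2) (hh : h = 0 ∨ h = 1) (hi : 1 ≤ i)
    (hg : orderOf (g : ZMod (p ^ i)) = Nat.totient (p ^ i)) :
    z ∈ GC h g 1 (ε * p ^ i) (p ^ (i - 1) * (p - 1) / 2) 1 ↔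
      z < ε * p ^ i ∧ z.Coprime (ε * p ^ i) ∧ J((z : ℤ) | p) = (-1) ^ h := by
  have : NeZero (p ^ i) := ⟨pow_ne_zero _ hp.ne_zero⟩
  have hφ := Nat.totient_prime_pow hp hi
  have hφpos : 0 < p ^ (i - 1) * (p - 1) := by
    rw [← hφ]; exact Nat.totient_pos.2 (NeZero.pos _)
  refine mem_GC_iff (Nat.mul_pos (by omega) (NeZero.pos _))
    ((dvd_pow_self p (by omega)).trans (dvd_mul_left _ _)) ?_ (Nat.coprime_one_left _) hJ
    (by simp) ?_ hh
  · refine Nat.Coprime.mul_right ?_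
      ((coprime_of_jacobiSym_ne_zero hp.ne_zero (by simp [hJ])).pow_right i)
    rcases hε with rfl | rfl
    · simp
    · rwa [Nat.coprime_two_right]
  · intro z hz
    obtain ⟨A, hA⟩ := exists_pow_modEq_of_orderOf_eq_totient hg
      (hz.coprime_dvd_right (dvd_mul_left _ ε))
    refine ⟨A % (p ^ (i - 1) * (p - 1)), ?_, 0, one_pos, ?_⟩
    · rw [Nat.mul_div_cancel' (even_pow_mul_pred hodd _).two_dvd]
      exact Nat.mod_lt _ hφpos
    · rw [pow_zero, mul_one]
      exact modEq_mul_of_odd hε hodd.pow hgodd.pow (hz.coprime_dvd_right (dvd_mul_right _ _))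
        ((pow_modEq_pow_of_orderOf (hg.trans hφ) (Nat.mod_modEq _ _)).trans hA)

/-- The quadratic character of `u` after removing its common factor with `M`, taken at `q` when
`q` still divides the remaining modulus and at `p` otherwise. -/
def strippedSign (p q M u : ℕ) : ℤ :=
  if q ∣ M / u.gcd M then J((u / u.gcd M : ℕ) | q) else J((u / u.gcd M : ℕ) | p)

namespace CyclotomicSetup

variable {p q m n g y : ℕ}

/-- Writing the gcd with `p ^ m * q ^ n` as `p ^ (m - i) * q ^ (n - j)`. -/
lemma exists_gcd_eq (S : CyclotomicSetup p q m n g y) {u : ℕ} (hu : ¬ p ^ m * q ^ n ∣ u) :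
    ∃ i ≤ m, ∃ j ≤ n, ¬ (i = 0 ∧ j = 0) ∧ ∃ z, u = p ^ (m - i) * q ^ (n - j) * z ∧
      z.Coprime (p ^ i * q ^ j) := by
  have hM : 0 < p ^ m * q ^ n := by simpa using S.modulus_pos (Or.inl rfl) m n
  obtain ⟨G, hG⟩ : ∃ G, G = u.gcd (p ^ m * q ^ n) := ⟨_, rfl⟩
  have hGM : G ∣ p ^ m * q ^ n := hG ▸ Nat.gcd_dvd_right _ _
  have hGu : G ∣ u := hG ▸ Nat.gcd_dvd_left _ _
  obtain ⟨P, Q, hP, hQ, hPQ⟩ := (Nat.dvd_mul).1 hGM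
  obtain ⟨i, hi, rfl⟩ := (Nat.dvd_prime_pow S.hp).1 hP
  obtain ⟨j, hj, rfl⟩ := (Nat.dvd_prime_pow S.hq).1 hQ
  have hsplit : p ^ m * q ^ n = G * (p ^ (m - i) * q ^ (n - j)) := by
    rw [← hPQ, mul_mul_mul_comm, ← pow_add, ← pow_add, Nat.add_sub_cancel' hi,
      Nat.add_sub_cancel' hj]
  have hGpos : 0 < G := Nat.pos_of_dvd_of_pos hGM hM
  refine ⟨m - i, Nat.sub_le _ _, n - j, Nat.sub_le _ _, ?_, u / G, ?_, ?_⟩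
  · rintro ⟨h1, h2⟩
    rw [h1, h2, pow_zero, pow_zero, mul_one, mul_one] at hsplit
    exact hu (hsplit ▸ hGu)
  · rw [Nat.sub_sub_self hi, Nat.sub_sub_self hj, hPQ, Nat.mul_div_cancel' hGu]
  · have := Nat.coprime_div_gcd_div_gcd (m := u) (n := p ^ m * q ^ n) (hG ▸ hGpos)
    rw [← hG] at this
    rwa [hsplit, Nat.mul_div_cancel_left _ hGpos] at this

lemma gcd_eq {i j z : ℕ} (hi : i ≤ m) (hj : j ≤ n)
    (hz : z.Coprime (p ^ i * q ^ j)) :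
    (p ^ (m - i) * q ^ (n - j) * z).gcd (p ^ m * q ^ n) = p ^ (m - i) * q ^ (n - j) ∧
      p ^ m * q ^ n = p ^ (m - i) * q ^ (n - j) * (p ^ i * q ^ j) := by
  have hsplit : p ^ m * q ^ n = p ^ (m - i) * q ^ (n - j) * (p ^ i * q ^ j) := by
    rw [mul_mul_mul_comm, ← pow_add, ← pow_add, Nat.sub_add_cancel hi, Nat.sub_add_cancel hj]
  refine ⟨?_, hsplit⟩
  rw [hsplit, Nat.gcd_mul_left, hz.gcd_eq_one, mul_one]

lemma strippedSign_eq (S : CyclotomicSetup p q m n g y) {i j z : ℕ} (hi : i ≤ m) (hj : j ≤ n)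
    (hz : z.Coprime (p ^ i * q ^ j)) :
    strippedSign p q (p ^ m * q ^ n) (p ^ (m - i) * q ^ (n - j) * z) =
      J((z : ℤ) | if j = 0 then p else q) := by
  have hpos : 0 < p ^ (m - i) * q ^ (n - j) := by
    simpa using S.modulus_pos (Or.inl rfl) (m - i) (n - j)
  obtain ⟨h1, h2⟩ := gcd_eq hi hj hz
  rw [strippedSign, h1, Nat.mul_div_cancel_left _ hpos]
  rw [h2, Nat.mul_div_cancel_left _ hpos]
  rcases Nat.eq_zero_or_pos j with rfl | hj0
  · rw [if_neg, if_pos rfl]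
    rw [pow_zero, mul_one]
    intro h
    exact S.hpq ((Nat.prime_dvd_prime_iff_eq S.hq S.hp).1 (S.hq.dvd_of_dvd_pow h)).symm
  · rw [if_pos ((dvd_pow_self q hj0.ne').trans (dvd_mul_left _ _)), if_neg hj0.ne']

lemma strippedSign_congr (S : CyclotomicSetup p q m n g y) {u v : ℕ}
    (hu : ¬ p ^ m * q ^ n ∣ u) (h : u ≡ v [MOD p ^ m * q ^ n]) :
    strippedSign p q (p ^ m * q ^ n) u = strippedSign p q (p ^ m * q ^ n) v := by
  obtain ⟨i, hi, j, hj, hij, z, rfl, hz⟩ := S.exists_gcd_eq hu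
  have hpos : 0 < p ^ (m - i) * q ^ (n - j) := by
    simpa using S.modulus_pos (Or.inl rfl) (m - i) (n - j)
  obtain ⟨h1, h2⟩ := gcd_eq hi hj hz
  rw [h2] at h
  obtain ⟨w, rfl⟩ : p ^ (m - i) * q ^ (n - j) ∣ v :=
    (h.dvd_iff (dvd_mul_right _ _)).1 (dvd_mul_right _ _)
  have h3 : z ≡ w [MOD p ^ i * q ^ j] := Nat.ModEq.mul_left_cancel' hpos.ne' h
  have hw : w.Coprime (p ^ i * q ^ j) := by
    rw [Nat.Coprime, ← h3.gcd_eq]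
    exact hz
  rw [S.strippedSign_eq hi hj hz, S.strippedSign_eq hi hj hw]
  refine jacobiSym_congr (h3.of_dvd ?_)
  split_ifs with hj0
  · exact (dvd_pow_self p (by omega)).trans (dvd_mul_right _ _)
  · exact (dvd_pow_self q hj0).trans (dvd_mul_left _ _)

lemma strippedSign_two_mul (S : CyclotomicSetup p q m n g y)
    (hp8 : p % 8 = 3 ∨ p % 8 = 5) (hq8 : q % 8 = 3 ∨ q % 8 = 5) {u : ℕ}
    (hu : ¬ p ^ m * q ^ n ∣ u) :
    strippedSign p q (p ^ m * q ^ n) (2 * u) = - strippedSign p q (p ^ m * q ^ n) u := by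
  obtain ⟨i, hi, j, hj, -, z, rfl, hz⟩ := S.exists_gcd_eq hu
  have h2z : (2 * z).Coprime (p ^ i * q ^ j) :=
    Nat.Coprime.mul_left (Nat.coprime_two_left.2 (S.odd_modulus i j)) hz
  rw [mul_left_comm, S.strippedSign_eq hi hj hz, S.strippedSign_eq hi hj h2z]
  push_cast
  rw [jacobiSym.mul_left]
  split_ifs
  · rw [jacobiSym_two_eq_neg_one hp8, neg_one_mul]
  · rw [jacobiSym_two_eq_neg_one hq8, neg_one_mul]

lemma strippedSign_eq_one_or_neg_one (S : CyclotomicSetup p q m n g y) {u : ℕ}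
    (hu : ¬ p ^ m * q ^ n ∣ u) :
    strippedSign p q (p ^ m * q ^ n) u = 1 ∨ strippedSign p q (p ^ m * q ^ n) u = -1 := by
  obtain ⟨i, hi, j, hj, hij, z, rfl, hz⟩ := S.exists_gcd_eq hu
  rw [S.strippedSign_eq hi hj hz]
  refine jacobiSym.eq_one_or_neg_one ?_
  rw [Int.gcd_natCast_natCast]
  refine hz.coprime_dvd_right ?_
  split_ifs with hj0
  · exact (dvd_pow_self p (by omega)).trans (dvd_mul_right _ _)
  · exact (dvd_pow_self q hj0).trans (dvd_mul_left _ _)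

end CyclotomicSetup

lemma mem_scaled {c x : ℕ} {A : Finset ℕ} : x ∈ scaled c A ↔ ∃ z ∈ A, c * z = x := by
  simp [scaled]

namespace CyclotomicSetup

variable {p q m n g y : ℕ}

lemma sign_eq_iff (S : CyclotomicSetup p q m n g y) {ε x : ℕ} {σ : ℤ} (hε : ε = 1 ∨ ε = 2) :
    (∃ i ≤ m, ∃ j ≤ n, ¬ (i = 0 ∧ j = 0) ∧ ∃ z, p ^ (m - i) * q ^ (n - j) * z = x ∧
      z < ε * (p ^ i * q ^ j) ∧ z.Coprime (ε * (p ^ i * q ^ j)) ∧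
      J((z : ℤ) | if j = 0 then p else q) = σ) ↔
    x < ε * (p ^ m * q ^ n) ∧ x.Coprime ε ∧ ¬ p ^ m * q ^ n ∣ x ∧
      strippedSign p q (p ^ m * q ^ n) x = σ := by
  constructor
  · rintro ⟨i, hi, j, hj, hij, z, rfl, hlt, hco, hJ⟩
    have hco' := hco.coprime_dvd_right (dvd_mul_left _ ε)
    obtain ⟨h1, h2⟩ := gcd_eq hi hj hco'
    have hpos : 0 < p ^ (m - i) * q ^ (n - j) := by
      simpa using S.modulus_pos (Or.inl rfl) (m - i) (n - j)
    refine ⟨?_, ?_, ?_, ?_⟩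
    · rw [h2, mul_left_comm]
      exact Nat.mul_lt_mul_of_pos_left hlt hpos
    · refine Nat.Coprime.mul_left ?_ (hco.coprime_dvd_right (dvd_mul_right _ _))
      rcases hε with rfl | rfl
      · simp
      · exact Nat.coprime_two_right.2 (S.odd_modulus _ _)
    · intro hdvd
      rw [Nat.gcd_eq_right hdvd, h2] at h1
      have h3 : p ^ i * q ^ j = 1 := Nat.eq_of_mul_eq_mul_left hpos (by rw [h1, mul_one])
      have h4 := Nat.eq_one_of_mul_eq_one_right h3
      have h5 := Nat.eq_one_of_mul_eq_one_left h3
      rw [Nat.pow_eq_one] at h4 h5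
      have := S.hp.ne_one
      have := S.hq.ne_one
      tauto
    · rw [S.strippedSign_eq hi hj hco', hJ]
  · rintro ⟨hlt, hco, hdvd, hJ⟩
    obtain ⟨i, hi, j, hj, hij, z, rfl, hz⟩ := S.exists_gcd_eq hdvd
    refine ⟨i, hi, j, hj, hij, z, rfl, ?_, ?_, ?_⟩
    · rw [(gcd_eq hi hj hz).2, mul_left_comm] at hlt
      exact Nat.lt_of_mul_lt_mul_left hlt
    · exact (hco.coprime_dvd_left (dvd_mul_left _ _)).mul_right hz
    · rw [← hJ, S.strippedSign_eq hi hj hz]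

lemma mem_classes_iff (S : CyclotomicSetup p q m n g y) {ε h x : ℕ} (hε : ε = 1 ∨ ε = 2)
    (hh : h = 0 ∨ h = 1) :
    (((∃ i, (1 ≤ i ∧ i ≤ m) ∧ ∃ j, (1 ≤ j ∧ j ≤ n) ∧ x ∈ scaled (p ^ (m - i) * q ^ (n - j))
        (GC h g y (ε * (p ^ i * q ^ j)) (dij p q i j / 2) (eij p q i j))) ∨
      (∃ i, (1 ≤ i ∧ i ≤ m) ∧ x ∈ scaled (p ^ (m - i) * q ^ n)
        (GC h g 1 (ε * p ^ i) (p ^ (i - 1) * (p - 1) / 2) 1))) ∨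
      (∃ j, (1 ≤ j ∧ j ≤ n) ∧ x ∈ scaled (p ^ m * q ^ (n - j))
        (GC h g 1 (ε * q ^ j) (q ^ (j - 1) * (q - 1) / 2) 1))) ↔
    x < ε * (p ^ m * q ^ n) ∧ x.Coprime ε ∧ ¬ p ^ m * q ^ n ∣ x ∧
      strippedSign p q (p ^ m * q ^ n) x = (-1) ^ h := by
  rw [← S.sign_eq_iff hε]
  constructor
  · rintro ((⟨i, hi, j, hj, hx⟩ | ⟨i, hi, hx⟩) | ⟨j, hj, hx⟩)
    · obtain ⟨z, hz, rfl⟩ := mem_scaled.1 hx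
      rw [S.mem_GC_pq hε hh hi.1 hi.2 hj.1 hj.2] at hz
      refine ⟨i, hi.2, j, hj.2, by omega, z, rfl, hz.1, hz.2.1, ?_⟩
      rw [if_neg (by omega)]
      exact hz.2.2
    · obtain ⟨z, hz, rfl⟩ := mem_scaled.1 hx
      rw [mem_GC_prime_pow S.hp S.hpodd S.hgodd S.jacobi_g_p hε hh hi.1 (S.hgp i hi.1 hi.2)] at hz
      exact ⟨i, hi.2, 0, Nat.zero_le _, by omega, z, by simpa using hz⟩
    · obtain ⟨z, hz, rfl⟩ := mem_scaled.1 hx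
      rw [mem_GC_prime_pow S.hq S.hqodd S.hgodd S.jacobi_g_q hε hh hj.1 (S.hgq j hj.1 hj.2)] at hz
      refine ⟨0, Nat.zero_le _, j, hj.2, by omega, z, ?_⟩
      rw [if_neg (by omega)]
      simpa using hz
  · rintro ⟨i, hi, j, hj, hij, z, rfl, hz⟩
    rcases Nat.eq_zero_or_pos j with rfl | hj0
    · refine Or.inl (Or.inr ⟨i, ⟨by omega, hi⟩, mem_scaled.2 ⟨z, ?_, by simp⟩⟩)
      have hi0 : 1 ≤ i := by omega
      rw [mem_GC_prime_pow S.hp S.hpodd S.hgodd S.jacobi_g_p hε hh hi0 (S.hgp i hi0 hi)]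
      simpa using hz
    · rw [if_neg hj0.ne'] at hz
      rcases Nat.eq_zero_or_pos i with rfl | hi0
      · refine Or.inr ⟨j, ⟨hj0, hj⟩, mem_scaled.2 ⟨z, ?_, by simp⟩⟩
        rw [mem_GC_prime_pow S.hq S.hqodd S.hgodd S.jacobi_g_q hε hh hj0 (S.hgq j hj0 hj)]
        simpa using hz
      · refine Or.inl (Or.inl ⟨i, ⟨hi0, hi⟩, j, ⟨hj0, hj⟩, mem_scaled.2 ⟨z, ?_, rfl⟩⟩)
        rwa [S.mem_GC_pq hε hh hi0 hi hj0 hj]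

lemma mem_UnionH_iff (S : CyclotomicSetup p q m n g y) {h x : ℕ} (hh : h = 0 ∨ h = 1) :
    x ∈ UnionH p q m n g y h ↔ x < 2 * (p ^ m * q ^ n) ∧ Odd x ∧ ¬ p ^ m * q ^ n ∣ x ∧
      strippedSign p q (p ^ m * q ^ n) x = (-1) ^ h := by
  rw [← Nat.coprime_two_right, ← S.mem_classes_iff (Or.inr rfl) hh]
  simp only [UnionH, mem_union, mem_biUnion, mem_Icc, H2PQ, H2P, H2Q, D2PQ, D2P, D2Q]

lemma mem_Union2H_iff (S : CyclotomicSetup p q m n g y) {h x : ℕ} (hh : h = 0 ∨ h = 1) :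
    x ∈ Union2H p q m n g y h ↔ ∃ w, 2 * w = x ∧ w < p ^ m * q ^ n ∧ ¬ p ^ m * q ^ n ∣ w ∧
      strippedSign p q (p ^ m * q ^ n) w = (-1) ^ h := by
  have key := fun w => S.mem_classes_iff (x := w) (Or.inl rfl) hh
  simp only [one_mul, Nat.coprime_one_right_eq_true, true_and] at key
  simp only [← key, Union2H, mem_union, mem_biUnion, mem_Icc, HPQ, HP, HQ, DPQ, DP, DQ,
    mem_scaled (c := 2)]
  constructor
  · rintro ((⟨i, hi, j, hj, w, hw, rfl⟩ | ⟨i, hi, w, hw, rfl⟩) | ⟨j, hj, w, hw, rfl⟩)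
    · exact ⟨w, rfl, Or.inl (Or.inl ⟨i, hi, j, hj, hw⟩)⟩
    · exact ⟨w, rfl, Or.inl (Or.inr ⟨i, hi, hw⟩)⟩
    · exact ⟨w, rfl, Or.inr ⟨j, hj, hw⟩⟩
  · rintro ⟨w, rfl, (⟨i, hi, j, hj, hw⟩ | ⟨i, hi, hw⟩) | ⟨j, hj, hw⟩⟩
    · exact Or.inl (Or.inl ⟨i, hi, j, hj, w, hw, rfl⟩)
    · exact Or.inl (Or.inr ⟨i, hi, w, hw, rfl⟩)
    · exact Or.inr ⟨j, hj, w, hw, rfl⟩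

variable {a b c d e : F4}

lemma seqS_odd (S : CyclotomicSetup p q m n g y) {u : ℕ} (hu : Odd u)
    (hlt : u < 2 * (p ^ m * q ^ n)) (hM : ¬ p ^ m * q ^ n ∣ u) :
    seqS p q m n g y a b c d e u = if strippedSign p q (p ^ m * q ^ n) u = 1 then a else b := by
  have h0 : u ≠ 0 := by rintro rfl; simp at hM
  have h1 : u ≠ p ^ m * q ^ n := by rintro rfl; simp at hM
  simp only [seqS, Nat.mod_eq_of_lt hlt, if_neg h0, if_neg h1, S.mem_UnionH_iff (Or.inl rfl),
    S.mem_UnionH_iff (Or.inr rfl), hlt, hu, hM, true_and, not_false_eq_true, pow_zero, pow_one]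
  rcases S.strippedSign_eq_one_or_neg_one hM with h | h <;> simp [h]

lemma seqS_even (S : CyclotomicSetup p q m n g y)
    (hp8 : p % 8 = 3 ∨ p % 8 = 5) (hq8 : q % 8 = 3 ∨ q % 8 = 5) {u : ℕ} (hu : Even u)
    (hlt : u < 2 * (p ^ m * q ^ n)) (hM : ¬ p ^ m * q ^ n ∣ u) :
    seqS p q m n g y a b c d e u = if strippedSign p q (p ^ m * q ^ n) u = 1 then d else c := by
  have h0 : u ≠ 0 := by rintro rfl; simp at hM
  have h1 : u ≠ p ^ m * q ^ n := by rintro rfl; simp at hM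
  obtain ⟨w, rfl⟩ := hu.two_dvd
  have hw : w < p ^ m * q ^ n := by omega
  have hwM : ¬ p ^ m * q ^ n ∣ w := fun h => hM (h.mul_left 2)
  have hmem : ∀ h, h = 0 ∨ h = 1 → (2 * w ∈ Union2H p q m n g y h ↔
      strippedSign p q (p ^ m * q ^ n) w = (-1) ^ h) := by
    intro h hh
    rw [S.mem_Union2H_iff hh]
    constructor
    · rintro ⟨w', hw', -, -, h'⟩
      rwa [← Nat.eq_of_mul_eq_mul_left two_pos hw']
    · exact fun h' => ⟨w, rfl, hw, hwM, h'⟩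
  have hodd : ¬ Odd (2 * w) := by simp
  simp only [seqS, Nat.mod_eq_of_lt hlt, if_neg h0, if_neg h1, S.mem_UnionH_iff (Or.inl rfl),
    S.mem_UnionH_iff (Or.inr rfl), hodd, false_and, and_false, if_false, hmem 0 (Or.inl rfl),
    hmem 1 (Or.inr rfl), S.strippedSign_two_mul hp8 hq8 hwM, pow_zero, pow_one]
  rcases S.strippedSign_eq_one_or_neg_one hwM with h | h <;> simp [h]

end CyclotomicSetup

lemma F4_add_eq_add {a b c d : F4} (hab : a ≠ b) (hac : a ≠ c) (had : a ≠ d) (hbc : b ≠ c)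
    (hbd : b ≠ d) (hcd : c ≠ d) : a + d = b + c := by
  classical
  have := Fintype.ofFinite F4
  have hcard : Fintype.card F4 = 4 := by
    rw [← Nat.card_eq_fintype_card, GaloisField.card 2 2 two_ne_zero]
    norm_num
  have huniv : ({a, b, c, d} : Finset F4) = univ := by
    rw [← Finset.card_eq_iff_eq_univ, hcard]
    simp [*]
  have hsum := FiniteField.sum_pow_lt_card_sub_one F4 1 (by rw [hcard]; norm_num)
  rw [← huniv] at hsum
  simp only [pow_one] at hsum
  rw [sum_insert (by simp [*]), sum_insert (by simp [*]), sum_insert (by simp [*]),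
    sum_singleton] at hsum
  rw [← sub_eq_zero, CharTwo.sub_eq_add, ← hsum]
  ring

namespace CyclotomicSetup

variable {p q m n g y : ℕ} {a b c d e : F4}

lemma seqS_add_seqS (S : CyclotomicSetup p q m n g y)
    (hp8 : p % 8 = 3 ∨ p % 8 = 5) (hq8 : q % 8 = 3 ∨ q % 8 = 5) (habcd : a + d = b + c)
    {u : ℕ} (hu0 : u ≠ 0) (hu : u < p ^ m * q ^ n) :
    seqS p q m n g y a b c d e u + seqS p q m n g y a b c d e (p ^ m * q ^ n + u) = b + c := by
  have hM : ¬ p ^ m * q ^ n ∣ u := fun h => hu.not_ge (Nat.le_of_dvd (Nat.pos_of_ne_zero hu0) h)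
  have hM' : ¬ p ^ m * q ^ n ∣ p ^ m * q ^ n + u := by simpa using hM
  have hsign := S.strippedSign_congr hM (v := p ^ m * q ^ n + u) (by simp [Nat.ModEq])
  have hMo := S.odd_modulus m n
  rcases Nat.even_or_odd u with he | ho
  · rw [S.seqS_even hp8 hq8 he (by omega) hM, S.seqS_odd (hMo.add_even he) (by omega) hM', ← hsign]
    split_ifs
    · rw [add_comm, habcd]
    · rw [add_comm]
  · rw [S.seqS_odd ho (by omega) hM, S.seqS_even hp8 hq8 (hMo.add_odd ho) (by omega) hM', ← hsign]
    split_ifs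
    · exact habcd
    · rfl

lemma aeval_genPoly (S : CyclotomicSetup p q m n g y)
    (hp8 : p % 8 = 3 ∨ p % 8 = 5) (hq8 : q % 8 = 3 ∨ q % 8 = 5) (habcd : a + d = b + c)
    {K : Type*} [Field K] [Algebra F4 K] {γ : K} (hγ : γ ^ (p ^ m * q ^ n) = 1) (hγ1 : γ ≠ 1) :
    aeval γ (genPoly p q m n g y a b c d e) = algebraMap F4 K (e + b + c) := by
  have hpos : 0 < p ^ m * q ^ n := by simpa using S.modulus_pos (Or.inl rfl) m n
  have hpair := fun u => S.seqS_add_seqS (e := e) hp8 hq8 habcd (u := u)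
  have hzero : seqS p q m n g y a b c d e 0 + seqS p q m n g y a b c d e (p ^ m * q ^ n) = e := by
    have h1 : p ^ m * q ^ n % (2 * (p ^ m * q ^ n)) = p ^ m * q ^ n :=
      Nat.mod_eq_of_lt (by omega)
    simp [seqS, h1, hpos.ne']
  have hgeom : ∑ u ∈ range (p ^ m * q ^ n), γ ^ u = 0 := by
    rw [geom_sum_eq hγ1, hγ, sub_self, zero_div]
  have hfold : aeval γ (genPoly p q m n g y a b c d e) = ∑ u ∈ range (p ^ m * q ^ n),
      algebraMap F4 K (seqS p q m n g y a b c d e u +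
        seqS p q m n g y a b c d e (p ^ m * q ^ n + u)) * γ ^ u := by
    simp only [genPoly, map_sum, map_mul, aeval_C, map_pow, aeval_X]
    rw [two_mul, sum_range_add, ← sum_add_distrib]
    refine sum_congr rfl fun u _ => ?_
    rw [pow_add, hγ, one_mul, map_add, add_mul]
  obtain ⟨M, hM⟩ := Nat.exists_eq_succ_of_ne_zero hpos.ne'
  have hrest : ∑ u ∈ range M, algebraMap F4 K (seqS p q m n g y a b c d e (u + 1) +
        seqS p q m n g y a b c d e (p ^ m * q ^ n + (u + 1))) * γ ^ (u + 1) =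
      algebraMap F4 K (b + c) * ∑ u ∈ range M, γ ^ (u + 1) := by
    rw [mul_sum]
    refine sum_congr rfl fun u hu => ?_
    rw [hpair (u + 1) (by omega) (by have := mem_range.1 hu; omega)]
  have hgeom' : ∑ u ∈ range M, γ ^ (u + 1) = -1 := by
    rw [hM, Nat.succ_eq_add_one, sum_range_succ', pow_zero] at hgeom
    exact eq_neg_of_add_eq_zero_left hgeom
  have hrange : range (p ^ m * q ^ n) = range (M + 1) := by rw [hM]
  rw [hfold, hrange, sum_range_succ', hrest, hgeom', add_zero, hzero, pow_zero, mul_one,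
    mul_neg_one, ← map_neg, ← map_add, CharTwo.neg_eq]
  congr 1
  ring

end CyclotomicSetup

theorem statement14
    (p q m n g y : ℕ)
    (hp : p.Prime) (hq : q.Prime) (hpq : p ≠ q) (hpodd : Odd p) (hqodd : Odd q)
    (hm : 1 ≤ m) (hn : 1 ≤ n) (hgodd : Odd g)
    (hgp : ∀ i, 1 ≤ i → i ≤ m → orderOf (g : ZMod (p ^ i)) = Nat.totient (p ^ i))
    (hg2p : ∀ i, 1 ≤ i → i ≤ m → orderOf (g : ZMod (2 * p ^ i)) = Nat.totient (2 * p ^ i))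
    (hgq : ∀ j, 1 ≤ j → j ≤ n → orderOf (g : ZMod (q ^ j)) = Nat.totient (q ^ j))
    (hg2q : ∀ j, 1 ≤ j → j ≤ n → orderOf (g : ZMod (2 * q ^ j)) = Nat.totient (2 * q ^ j))
    (hylt : y < 2 * (p ^ m * q ^ n))
    (hyg : y ≡ g [MOD 2 * p ^ m]) (hy1 : y ≡ 1 [MOD 2 * q ^ n])
    (a b c d e : F4)
    (hab : a ≠ b) (hac : a ≠ c) (had : a ≠ d) (hbc : b ≠ c) (hbd : b ≠ d) (hcd : c ≠ d)
    (he : e ≠ 0)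
    (K : Type*) [Field K] [Fintype K] [Algebra F4 K]
    (hK : Fintype.card K = 4 ^ orderOf (4 : ZMod (p ^ m * q ^ n)))
    (β : K) (hβ : IsPrimitiveRoot β (p ^ m * q ^ n))
    (hp8 : p % 8 = 3 ∨ p % 8 = 5) (hq8 : q % 8 = 3 ∨ q % 8 = 5) :
    ∀ k, 1 ≤ k → k ≤ p ^ m * q ^ n - 1 →
      Polynomial.aeval (β ^ k) (genPoly p q m n g y a b c d e)
        = algebraMap F4 K (e + b + c) := by
  intro k hk1 hk2
  have hyg2 : y ≡ g [MOD 2] := hyg.of_dvd (dvd_mul_right _ _)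
  have hyodd : Odd y := by rw [Nat.odd_iff, hyg2, ← Nat.odd_iff]; exact hgodd
  have S : CyclotomicSetup p q m n g y :=
    ⟨hp, hq, hpq, hpodd, hqodd, hm, hn, hgodd, hyodd, hgp, hgq,
      hyg.of_dvd (dvd_mul_left _ _), hy1.of_dvd (dvd_mul_left _ _)⟩
  refine S.aeval_genPoly hp8 hq8 (F4_add_eq_add hab hac had hbc hbd hcd) ?_ ?_
  · rw [← pow_mul, mul_comm, pow_mul, hβ.pow_eq_one, one_pow]
  · exact hβ.pow_ne_one_of_pos_of_lt (by omega) (by omega)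

end
end
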